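/- For every ρ ∈ (0,∞), the ordered nonzero eigenvalues λ_1 ≥ λ_2 ≥ … > 0 of the covariance operator C_ρ of the Riemann–Liouville process X^ρ (the integral operator on L²([0,1], dt) with kernel K_ρ) satisfy λ_j ~ Γ(ρ+1/2)² · (π j)^{−(2ρ+1)} as j → ∞. -/

import Mathlib

open MeasureTheory ProbabilityTheory Filter Real
open scoped RealInnerProductSpace NNReal

/-- Lebesgue measure on `[0,1]`. -/
noncomputable def μ01 : MeasureTheory.Measure ℝ := MeasureTheory.volume.restrict (Set.Icc (0:ℝ) 1)

/-- The covariance kernel of the Riemann–Liouville process of index `ρ`: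
`K_ρ(s,t) = ∫₀^{s∧t} (t-r)^{ρ-1/2} (s-r)^{ρ-1/2} dr`. -/
noncomputable def rlKernel (ρ : ℝ) (s t : ℝ) : ℝ :=
  ∫ r in (0:ℝ)..(min s t), (t - r) ^ (ρ - 1/2) * (s - r) ^ (ρ - 1/2)

section VariationalBounds

variable {H : Type*} [NormedAddCommGroup H] [InnerProductSpace ℝ H]
  {T : H →L[ℝ] H} {u : ℕ → H} {lam : ℕ → ℝ}

/-- If `T` is bounded by `a` on a subspace cut out by at most `n` linear conditions, then the
eigenvalue of `T* T` of index `n` is at most `a ^ 2`. -/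
theorem eigenvalue_le_sq (hu : Orthonormal ℝ u) (hlam_anti : Antitone lam)
    (hT : ∀ j g, ⟪T (u j), T g⟫ = lam j * ⟪u j, g⟫)
    {ι : Type*} [Fintype ι] (W : ι → H) {n : ℕ} (hn : Fintype.card ι ≤ n) {a : ℝ}
    (h : ∀ g, (∀ i, ⟪W i, g⟫ = 0) → ‖T g‖ ≤ a * ‖g‖) : lam n ≤ a ^ 2 := by
  let comb : (Fin (n + 1) → ℝ) →ₗ[ℝ] H := Fintype.linearCombination ℝ fun j => u j
  let f : (Fin (n + 1) → ℝ) →ₗ[ℝ] (ι → ℝ) :=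
    LinearMap.pi fun i => (innerSL ℝ (W i)).toLinearMap ∘ₗ comb
  have hker : LinearMap.ker f ≠ ⊥ := LinearMap.ker_ne_bot_of_finrank_lt (by simp; omega)
  obtain ⟨v, hv, hv0⟩ := Submodule.exists_mem_ne_zero_of_ne_bot hker
  have hcomb : comb v = ∑ j, v j • u j := Fintype.linearCombination_apply ..
  have hu' : Orthonormal ℝ fun j : Fin (n + 1) => u j := hu.comp _ Fin.val_injective
  have hinner (j : Fin (n + 1)) : ⟪u j, comb v⟫ = v j := by
    rw [hcomb]; exact hu'.inner_right_fintype v j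
  have hnorm : ‖comb v‖ ^ 2 = ∑ j, v j ^ 2 := by
    rw [← real_inner_self_eq_norm_sq]
    nth_rw 1 [hcomb]
    simp [sum_inner, inner_smul_left, hinner, sq]
  have hTnorm : ‖T (comb v)‖ ^ 2 = ∑ j : Fin (n + 1), lam j * v j ^ 2 := by
    rw [← real_inner_self_eq_norm_sq]
    nth_rw 1 [hcomb]
    simp only [map_sum, map_smul, sum_inner, inner_smul_left, hT, hinner]
    exact Finset.sum_congr rfl fun j _ => by simp; ring
  have hle : lam n * ‖comb v‖ ^ 2 ≤ ‖T (comb v)‖ ^ 2 := by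
    rw [hTnorm, hnorm, Finset.mul_sum]
    gcongr with j
    exact hlam_anti (by omega)
  have hpos : 0 < ‖comb v‖ ^ 2 := by
    rw [hnorm]
    obtain ⟨j, hj⟩ := Function.ne_iff.1 hv0
    exact Finset.sum_pos' (fun _ _ => sq_nonneg _)
      ⟨j, Finset.mem_univ _, by positivity [show v j ≠ 0 from hj]⟩
  have hbd := h (comb v) fun i => congrFun (LinearMap.mem_ker.1 hv) i
  have : ‖T (comb v)‖ ^ 2 ≤ (a * ‖comb v‖) ^ 2 := by gcongr
  rw [mul_pow] at this
  exact le_of_mul_le_mul_right (hle.trans this) hpos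

theorem norm_sq_apply_le_of_orthogonal [CompleteSpace H] (hu : Orthonormal ℝ u)
    (hlam_pos : ∀ j, 0 < lam j) (hlam_anti : Antitone lam)
    (hT : ∀ j g, ⟪T (u j), T g⟫ = lam j * ⟪u j, g⟫)
    (hT0 : ∀ g, (∀ j, ⟪u j, g⟫ = 0) → T g = 0) {n : ℕ} {g : H}
    (hg : ∀ j < n, ⟪u j, g⟫ = 0) : ‖T g‖ ^ 2 ≤ lam n * ‖g‖ ^ 2 := by
  have hsq : Summable fun j => ‖⟪u j, g⟫‖ ^ 2 := hu.inner_products_summable g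
  obtain ⟨w, hw⟩ : Summable fun j => ⟪u j, g⟫ • u j :=
    (hu.orthogonalFamily.summable_iff_norm_sq_summable fun j => ⟪u j, g⟫).2 hsq
  have hinner (j) : ⟪u j, w⟫ = ⟪u j, g⟫ := by
    have h1 : HasSum (fun i => ⟪u j, ⟪u i, g⟫ • u i⟫) ⟪u j, w⟫ := hw.mapL (innerSL ℝ (u j))
    refine h1.unique ?_
    convert hasSum_ite_eq j ⟪u j, g⟫ using 2 with i
    rw [inner_smul_right, orthonormal_iff_ite.1 hu]
    rcases eq_or_ne i j with rfl | hij
    · simp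
    · simp [hij, hij.symm]
  have hTw : T g = T w := by
    rw [← sub_eq_zero, ← map_sub]
    exact hT0 _ fun j => by rw [inner_sub_right, hinner, sub_self]
  have hsum : HasSum (fun j => lam j * ‖⟪u j, g⟫‖ ^ 2) (‖T g‖ ^ 2) := by
    have h1 : HasSum (fun j => ⟪T g, T (⟪u j, g⟫ • u j)⟫) ⟪T g, T w⟫ :=
      (hw.mapL T).mapL (innerSL ℝ (T g))
    rw [← hTw, real_inner_self_eq_norm_sq] at h1
    convert h1 using 2 with j
    rw [map_smul, inner_smul_right, real_inner_comm (T (u j)), hT, norm_eq_abs, sq_abs]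
    ring
  refine (hasSum_le (fun j => ?_) hsum (hsq.hasSum.mul_left (lam n))).trans
    (mul_le_mul_of_nonneg_left (hu.tsum_inner_products_le g) (hlam_pos n).le)
  rcases lt_or_ge j n with hj | hj
  · simp [hg j hj]
  · exact mul_le_mul_of_nonneg_right (hlam_anti hj) (by positivity)

/-- If `T` is bounded below by `a` on the part of a space of dimension larger than `n + m` cut out
by `m` linear conditions, then the eigenvalue of `T* T` of index `n` is at least `a ^ 2`. -/
theorem sq_le_eigenvalue [CompleteSpace H] (hu : Orthonormal ℝ u)
    (hlam_pos : ∀ j, 0 < lam j) (hlam_anti : Antitone lam)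
    (hT : ∀ j g, ⟪T (u j), T g⟫ = lam j * ⟪u j, g⟫)
    (hT0 : ∀ g, (∀ j, ⟪u j, g⟫ = 0) → T g = 0)
    {ι κ : Type*} [Fintype ι] [Fintype κ] {e : κ → H} (he : LinearIndependent ℝ e) (W : ι → H)
    {n : ℕ} (hn : n + Fintype.card ι < Fintype.card κ) {a : ℝ} (ha : 0 ≤ a)
    (h : ∀ v : κ → ℝ, (∀ i, ⟪W i, ∑ k, v k • e k⟫ = 0) →
      a * ‖∑ k, v k • e k‖ ≤ ‖T (∑ k, v k • e k)‖) : a ^ 2 ≤ lam n := by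
  let comb : (κ → ℝ) →ₗ[ℝ] H := Fintype.linearCombination ℝ e
  let f : (κ → ℝ) →ₗ[ℝ] (ι ⊕ Fin n → ℝ) :=
    LinearMap.pi fun i => (innerSL ℝ (Sum.elim W (fun j : Fin n => u j) i)).toLinearMap ∘ₗ comb
  have hker : LinearMap.ker f ≠ ⊥ := LinearMap.ker_ne_bot_of_finrank_lt (by simp; omega)
  obtain ⟨v, hv, hv0⟩ := Submodule.exists_mem_ne_zero_of_ne_bot hker
  have hcomb : comb v = ∑ k, v k • e k := Fintype.linearCombination_apply ..
  have hf (i) : ⟪Sum.elim W (fun j : Fin n => u j) i, comb v⟫ = 0 :=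
    congrFun (LinearMap.mem_ker.1 hv) i
  have hne : comb v ≠ 0 := fun h0 => hv0 <|
    funext (Fintype.linearIndependent_iff.1 he v (hcomb.symm.trans h0))
  have h1 := h v fun i => by rw [← hcomb]; exact hf (Sum.inl i)
  rw [← hcomb] at h1
  have h2 := norm_sq_apply_le_of_orthogonal hu hlam_pos hlam_anti hT hT0 (n := n) (g := comb v)
    fun j hj => hf (Sum.inr ⟨j, hj⟩)
  have h3 : (a * ‖comb v‖) ^ 2 ≤ ‖T (comb v)‖ ^ 2 := by gcongr
  rw [mul_pow] at h3
  exact le_of_mul_le_mul_right (h3.trans h2) (by positivity)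

end VariationalBounds

section IntegralOperators

instance isProbabilityMeasure_μ01 : IsProbabilityMeasure μ01 := ⟨by simp [μ01]⟩

theorem ae_μ01_mem : ∀ᵐ t ∂μ01, t ∈ Set.Icc (0 : ℝ) 1 := ae_restrict_mem measurableSet_Icc

theorem integral_μ01 {E : Type*} [NormedAddCommGroup E] [NormedSpace ℝ E] (f : ℝ → E) :
    ∫ t, f t ∂μ01 = ∫ t in (0 : ℝ)..1, f t := by
  rw [intervalIntegral.integral_of_le zero_le_one, μ01, integral_Icc_eq_integral_Ioc]

theorem norm_sq_Lp_μ01 (g : Lp ℝ 2 μ01) : ‖g‖ ^ 2 = ∫ t, g t ^ 2 ∂μ01 := by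
  rw [← real_inner_self_eq_norm_sq, L2.inner_def]
  simp [sq]

theorem norm_toLp_μ01 {f : ℝ → ℝ} (hf : MemLp f 2 μ01) : ‖hf.toLp‖ = √(∫ t, f t ^ 2 ∂μ01) := by
  rw [← sqrt_sq (norm_nonneg _), norm_sq_Lp_μ01]
  congr 1
  exact integral_congr_ae (hf.coeFn_toLp.mono fun t ht => by simp only [ht])

theorem norm_le_of_ae_bound_μ01 {g : Lp ℝ 2 μ01} {C : ℝ} (hC : 0 ≤ C)
    (h : ∀ᵐ t ∂μ01, ‖g t‖ ≤ C) : ‖g‖ ≤ C :=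
  (Lp.norm_le_of_ae_bound hC h).trans (by simp [measureUnivNNReal])

/-- Cauchy–Schwarz inequality. -/
theorem integral_abs_mul_le {f : ℝ → ℝ} (hf : MemLp f 2 μ01) (g : Lp ℝ 2 μ01) :
    ∫ t, |f t * g t| ∂μ01 ≤ √(∫ t, f t ^ 2 ∂μ01) * ‖g‖ := by
  have hf' := hf.abs
  have hg' := (Lp.memLp g).abs
  have h := real_inner_le_norm hf'.toLp hg'.toLp
  rw [norm_toLp_μ01, norm_toLp_μ01, L2.inner_def] at h
  simp only [Pi.abs_apply, sq_abs, ← norm_sq_Lp_μ01, sqrt_sq (norm_nonneg g)] at h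
  refine le_of_eq_of_le (integral_congr_ae ?_) h
  filter_upwards [hf'.coeFn_toLp, hg'.coeFn_toLp] with t h1 h2
  simp [h1, h2, abs_mul, mul_comm]

theorem integrable_mul_Lp {f : ℝ → ℝ} (hf : MemLp f 2 μ01) (g : Lp ℝ 2 μ01) :
    Integrable (fun t => f t * g t) μ01 := hf.integrable_mul (Lp.memLp g)

/-- Measurable kernels on `[0,1]²` whose rows are bounded in `L²` by `M`. -/
structure RowBoundedKernel (k : ℝ → ℝ → ℝ) (M : ℝ) : Prop where
  measurable : Measurable (Function.uncurry k)
  memLp : ∀ r ∈ Set.Icc (0 : ℝ) 1, MemLp (k r) 2 μ01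
  bound : ∀ r ∈ Set.Icc (0 : ℝ) 1, √(∫ t, k r t ^ 2 ∂μ01) ≤ M

namespace RowBoundedKernel

variable {k : ℝ → ℝ → ℝ} {M : ℝ}

theorem integral_abs_le (hk : RowBoundedKernel k M) (g : Lp ℝ 2 μ01) {r : ℝ}
    (hr : r ∈ Set.Icc (0 : ℝ) 1) : ∫ t, |k r t * g t| ∂μ01 ≤ M * ‖g‖ :=
  (integral_abs_mul_le (hk.memLp r hr) g).trans (by gcongr; exact hk.bound r hr)

theorem stronglyMeasurable_mul (hk : RowBoundedKernel k M) (g : Lp ℝ 2 μ01) :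
    StronglyMeasurable (Function.uncurry fun r t => k r t * g t) :=
  (hk.measurable.mul ((Lp.stronglyMeasurable g).measurable.comp measurable_snd)).stronglyMeasurable

theorem aestronglyMeasurable_integral (hk : RowBoundedKernel k M) (g : Lp ℝ 2 μ01) :
    AEStronglyMeasurable (fun r => ∫ t, k r t * g t ∂μ01) μ01 :=
  (hk.stronglyMeasurable_mul g).integral_prod_right.aestronglyMeasurable

theorem memLp_integral (hk : RowBoundedKernel k M) (g : Lp ℝ 2 μ01) :
    MemLp (fun r => ∫ t, k r t * g t ∂μ01) 2 μ01 := by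
  refine MemLp.of_bound (hk.aestronglyMeasurable_integral g) (M * ‖g‖) ?_
  filter_upwards [ae_μ01_mem] with r hr
  exact (norm_integral_le_integral_norm _).trans (hk.integral_abs_le g hr)

/-- The integral operator with a row-bounded kernel. -/
theorem exists_operator (hk : RowBoundedKernel k M) :
    ∃ T : Lp ℝ 2 μ01 →L[ℝ] Lp ℝ 2 μ01, ∀ g, T g =ᵐ[μ01] fun r => ∫ t, k r t * g t ∂μ01 := by
  let T : Lp ℝ 2 μ01 →ₗ[ℝ] Lp ℝ 2 μ01 :=
    { toFun g := (hk.memLp_integral g).toLp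
      map_add' g₁ g₂ := by
        rw [← MemLp.toLp_add]
        refine MemLp.toLp_congr _ _ ?_
        filter_upwards [ae_μ01_mem] with r hr
        simp only [Pi.add_apply]
        rw [← integral_add (integrable_mul_Lp (hk.memLp r hr) g₁)
          (integrable_mul_Lp (hk.memLp r hr) g₂)]
        refine integral_congr_ae ?_
        filter_upwards [Lp.coeFn_add g₁ g₂] with t ht
        rw [ht, Pi.add_apply, mul_add]
      map_smul' c g := by
        rw [RingHom.id_apply, ← MemLp.toLp_const_smul]
        refine MemLp.toLp_congr _ _ (Eventually.of_forall fun r => ?_)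
        simp only [Pi.smul_apply, smul_eq_mul]
        rw [← integral_const_mul]
        refine integral_congr_ae ?_
        filter_upwards [Lp.coeFn_smul c g] with t ht
        rw [ht, Pi.smul_apply, smul_eq_mul]
        ring }
  have hT (g) : T g =ᵐ[μ01] fun r => ∫ t, k r t * g t ∂μ01 := (hk.memLp_integral g).coeFn_toLp
  refine ⟨T.mkContinuous M fun g => ?_, hT⟩
  have h0 : 0 ≤ M := (sqrt_nonneg _).trans (hk.bound 0 (by simp))
  refine norm_le_of_ae_bound_μ01 (by positivity) ?_
  filter_upwards [hT g, ae_μ01_mem] with r h1 hr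
  rw [h1]
  exact (norm_integral_le_integral_norm _).trans (hk.integral_abs_le g hr)

theorem integral_smul_comm (hk : RowBoundedKernel k M) (g : Lp ℝ 2 μ01) {E : Type*}
    [NormedAddCommGroup E] [NormedSpace ℝ E] [CompleteSpace E] {y : ℝ → E}
    (hy : Integrable y μ01) :
    ∫ r, (∫ t, k r t * g t ∂μ01) • y r ∂μ01 = ∫ t, g t • (∫ r, k r t • y r ∂μ01) ∂μ01 := by
  have hm : AEStronglyMeasurable (Function.uncurry fun r t => (k r t * g t) • y r)
      (μ01.prod μ01) :=
    (hk.stronglyMeasurable_mul g).aestronglyMeasurable.smul hy.aestronglyMeasurable.comp_fst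
  have h_int : Integrable (Function.uncurry fun r t => (k r t * g t) • y r) (μ01.prod μ01) := by
    refine (integrable_prod_iff hm).2 ⟨?_, ?_⟩
    · filter_upwards [ae_μ01_mem] with r hr
      exact (integrable_mul_Lp (hk.memLp r hr) g).smul_const (y r)
    · refine (hy.norm.const_mul (M * ‖g‖)).mono' hm.norm.integral_prod_right' ?_
      filter_upwards [ae_μ01_mem] with r hr
      simp only [Function.uncurry_apply_pair, norm_smul, integral_mul_const]
      rw [norm_mul, norm_norm, norm_of_nonneg (integral_nonneg fun _ => norm_nonneg _)]
      gcongr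
      exact hk.integral_abs_le g hr
  calc ∫ r, (∫ t, k r t * g t ∂μ01) • y r ∂μ01
      = ∫ r, ∫ t, (k r t * g t) • y r ∂μ01 ∂μ01 := by simp only [integral_smul_const]
    _ = ∫ t, ∫ r, (k r t * g t) • y r ∂μ01 ∂μ01 := integral_integral_swap h_int
    _ = _ := by
      refine integral_congr_ae (Eventually.of_forall fun t => ?_)
      simp only
      rw [← integral_smul]
      simp only [smul_smul, mul_comm]

end RowBoundedKernel

/-- Multiplication by a bounded measurable function. -/
theorem exists_mulOperator {φ : ℝ → ℝ} (hφ : Measurable φ) {M : ℝ}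
    (hM : ∀ t ∈ Set.Icc (0 : ℝ) 1, |φ t| ≤ M) :
    ∃ S : Lp ℝ 2 μ01 →L[ℝ] Lp ℝ 2 μ01, ∀ g, S g =ᵐ[μ01] fun t => φ t * g t := by
  have hbd (g : Lp ℝ 2 μ01) : ∀ᵐ t ∂μ01, ‖φ t * g t‖ ≤ M * ‖g t‖ := by
    filter_upwards [ae_μ01_mem] with t ht
    rw [norm_mul]
    gcongr
    exact hM t ht
  have hmem (g : Lp ℝ 2 μ01) : MemLp (fun t => φ t * g t) 2 μ01 :=
    (Lp.memLp g).of_le_mul (hφ.aestronglyMeasurable.mul (Lp.aestronglyMeasurable g)) (hbd g)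
  let S : Lp ℝ 2 μ01 →ₗ[ℝ] Lp ℝ 2 μ01 :=
    { toFun g := (hmem g).toLp
      map_add' g₁ g₂ := by
        rw [← MemLp.toLp_add]
        refine MemLp.toLp_congr _ _ ?_
        filter_upwards [Lp.coeFn_add g₁ g₂] with t ht
        simp only [Pi.add_apply]
        rw [ht, Pi.add_apply, mul_add]
      map_smul' c g := by
        rw [RingHom.id_apply, ← MemLp.toLp_const_smul]
        refine MemLp.toLp_congr _ _ ?_
        filter_upwards [Lp.coeFn_smul c g] with t ht
        simp [ht, mul_left_comm] }
  have hS (g) : S g =ᵐ[μ01] fun t => φ t * g t := (hmem g).coeFn_toLp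
  refine ⟨S.mkContinuous M fun g => Lp.norm_le_mul_norm_of_ae_le_mul ?_, hS⟩
  filter_upwards [hS g, hbd g] with t h1 h2
  rwa [h1]

end IntegralOperators

section VolterraKernel

/-- The function `x ↦ x₊ ^ (α - 1) * exp (-c x)`. -/
noncomputable def powExp (α c x : ℝ) : ℝ :=
  if 0 < x then x ^ (α - 1) * exp (-(c * x)) else 0

variable {α c : ℝ}

theorem measurable_powExp : Measurable (powExp α c) :=
  Measurable.ite measurableSet_Ioi (by fun_prop) measurable_const

theorem powExp_nonneg (x : ℝ) : 0 ≤ powExp α c x := by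
  unfold powExp
  split_ifs with h
  · positivity
  · rfl

theorem powExp_of_nonpos {x : ℝ} (hx : x ≤ 0) : powExp α c x = 0 := if_neg hx.not_gt

theorem powExp_of_pos {x : ℝ} (hx : 0 < x) :
    powExp α c x = x ^ (α - 1) * exp (-(c * x)) := if_pos hx

/-- The order of the singularity of `powExp` at the origin. -/
noncomputable def singOrder (α : ℝ) : ℝ := max 0 (1 - α)

theorem singOrder_nonneg : 0 ≤ singOrder α := le_max_left _ _

theorem singOrder_lt (hα : 1 / 2 < α) : 2 * singOrder α < 1 := by
  unfold singOrder
  rcases max_cases (0 : ℝ) (1 - α) with h | h <;> linarith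

theorem rpow_le_singOrder {x : ℝ} (hx : 0 < x) (hx1 : x ≤ 1) :
    x ^ (α - 1) ≤ x ^ (-singOrder α) := by
  apply rpow_le_rpow_of_exponent_ge hx hx1
  linarith [le_max_right 0 (1 - α), show singOrder α = max 0 (1 - α) from rfl]

theorem integrableOn_rpow_singOrder (hα : 1 / 2 < α) (d : ℝ) (hd : 0 ≤ d) :
    IntegrableOn (fun x : ℝ => (x ^ (-singOrder α)) ^ 2) (Set.Ioc 0 d) := by
  have h1 := intervalIntegral.intervalIntegrable_rpow' (a := 0) (b := d)
    (show -1 < -(2 * singOrder α) by linarith [singOrder_lt hα])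
  rw [intervalIntegrable_iff_integrableOn_Ioc_of_le hd] at h1
  refine h1.congr_fun (fun x hx => ?_) measurableSet_Ioc
  simp only
  rw [← rpow_natCast, ← rpow_mul hx.1.le]
  ring_nf

theorem integrableOn_powExp_sq (hα : 1 / 2 < α) (hc : 0 ≤ c) :
    IntegrableOn (fun x => powExp α c x ^ 2) (Set.Ioc (-1) 1) := by
  rw [← Set.Ioc_union_Ioc_eq_Ioc (show (-1 : ℝ) ≤ 0 by norm_num) zero_le_one]
  refine IntegrableOn.union ?_ ?_
  · refine integrableOn_zero.congr_fun (fun x hx => ?_) measurableSet_Ioc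
    simp [powExp_of_nonpos hx.2]
  · refine (integrableOn_rpow_singOrder hα 1 zero_le_one).mono'
      (measurable_powExp.pow_const 2).aestronglyMeasurable ?_
    refine (ae_restrict_mem measurableSet_Ioc).mono fun x hx => ?_
    rw [norm_of_nonneg (by positivity), powExp_of_pos hx.1]
    have hx0 := hx.1
    gcongr
    refine (mul_le_of_le_one_right (by positivity) ?_).trans (rpow_le_singOrder hx.1 hx.2)
    exact exp_le_one_iff.2 (by simp; positivity)

theorem intervalIntegrable_powExp_sq (hα : 1 / 2 < α) (hc : 0 ≤ c) {a b : ℝ} (ha : -1 ≤ a)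
    (hab : a ≤ b) (hb : b ≤ 1) : IntervalIntegrable (fun x => powExp α c x ^ 2) volume a b := by
  rw [intervalIntegrable_iff_integrableOn_Ioc_of_le hab]
  exact (integrableOn_powExp_sq hα hc).mono_set (Set.Ioc_subset_Ioc ha hb)

theorem integrable_μ01_iff {E : Type*} [NormedAddCommGroup E] {f : ℝ → E} :
    Integrable f μ01 ↔ IntervalIntegrable f volume 0 1 := by
  rw [intervalIntegrable_iff_integrableOn_Icc_of_le zero_le_one, IntegrableOn, μ01]

theorem rowBoundedKernel_powExp (hα : 1 / 2 < α) (hc : 0 ≤ c) :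
    RowBoundedKernel (fun r t => powExp α c (t - r))
      √(∫ x in (-1 : ℝ)..1, powExp α c x ^ 2) where
  measurable := measurable_powExp.comp (measurable_snd.sub measurable_fst)
  memLp r hr := by
    have hm : Measurable fun t => powExp α c (t - r) :=
      measurable_powExp.comp (measurable_id.sub_const r)
    rw [memLp_two_iff_integrable_sq hm.aestronglyMeasurable, integrable_μ01_iff]
    convert (intervalIntegrable_powExp_sq (c := c) hα hc (a := 0 - r) (b := 1 - r)
      (by linarith [hr.2])
      (by linarith) (by linarith [hr.1])).comp_sub_right r using 1 <;> simp
  bound r hr := by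
    apply sqrt_le_sqrt
    rw [integral_μ01, intervalIntegral.integral_comp_sub_right (fun x => powExp α c x ^ 2) r]
    exact intervalIntegral.integral_mono_interval (by linarith [hr.2]) (by linarith)
      (by linarith [hr.1]) (Eventually.of_forall fun x => sq_nonneg _)
      (intervalIntegrable_powExp_sq hα hc le_rfl (by norm_num) le_rfl)

theorem memLp_powExp_sub_left (hα : 1 / 2 < α) (hc : 0 ≤ c) {t : ℝ} (ht : t ∈ Set.Icc (0 : ℝ) 1) :
    MemLp (fun r => powExp α c (t - r)) 2 μ01 := by
  have hm : Measurable fun r => powExp α c (t - r) :=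
    measurable_powExp.comp (measurable_id.const_sub t)
  rw [memLp_two_iff_integrable_sq hm.aestronglyMeasurable, integrable_μ01_iff]
  convert ((intervalIntegrable_powExp_sq (c := c) hα hc (a := t - 1) (b := t - 0)
    (by linarith [ht.1])
    (by linarith) (by linarith [ht.2])).comp_sub_left t).symm using 1 <;> simp

theorem rlKernel_eq_integral_powExp (ρ : ℝ) {s t : ℝ} (hs : s ∈ Set.Icc (0 : ℝ) 1)
    (ht : t ∈ Set.Icc (0 : ℝ) 1) :
    ∫ r, powExp (ρ + 1 / 2) 0 (s - r) * powExp (ρ + 1 / 2) 0 (t - r) ∂μ01 = rlKernel ρ s t := by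
  have hind : (fun r => powExp (ρ + 1 / 2) 0 (s - r) * powExp (ρ + 1 / 2) 0 (t - r)) =
      (Set.Iio (min s t)).indicator
        fun r => (t - r) ^ (ρ - 1 / 2) * (s - r) ^ (ρ - 1 / 2) := by
    funext r
    by_cases hr : r ∈ Set.Iio (min s t)
    · have h1 : 0 < s - r := sub_pos.2 (lt_min_iff.1 hr).1
      have h2 : 0 < t - r := sub_pos.2 (lt_min_iff.1 hr).2
      rw [Set.indicator_of_mem hr, powExp_of_pos h1, powExp_of_pos h2]
      simp only [zero_mul, neg_zero, exp_zero, mul_one]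
      rw [mul_comm, show ρ + 1 / 2 - 1 = ρ - 1 / 2 by ring]
    · rw [Set.indicator_of_notMem hr]
      rcases min_le_iff.1 (not_lt.1 (Set.mem_Iio.not.1 hr)) with h | h
      · rw [powExp_of_nonpos (by linarith), zero_mul]
      · rw [powExp_of_nonpos (x := t - r) (by linarith), mul_zero]
  have hset : Set.Icc (0 : ℝ) 1 ∩ Set.Iio (min s t) = Set.Ico 0 (min s t) := by
    ext r
    simp only [Set.mem_inter_iff, Set.mem_Icc, Set.mem_Iio, Set.mem_Ico]
    exact ⟨fun h => ⟨h.1.1, h.2⟩,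
      fun h => ⟨⟨h.1, h.2.le.trans ((min_le_left _ _).trans hs.2)⟩, h.2⟩⟩
  rw [hind, μ01, setIntegral_indicator measurableSet_Iio, hset, integral_Ico_eq_integral_Ioc,
    rlKernel, intervalIntegral.integral_of_le (le_min hs.1 ht.1)]

theorem inner_volterra_apply {ρ : ℝ} (hρ : 0 < ρ) {T : Lp ℝ 2 μ01 →L[ℝ] Lp ℝ 2 μ01}
    (hT : ∀ g, T g =ᵐ[μ01] fun r => ∫ t, powExp (ρ + 1 / 2) 0 (t - r) * g t ∂μ01)
    (g g' : Lp ℝ 2 μ01) :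
    ⟪T g, T g'⟫ = ∫ t, g' t * (∫ s in (0 : ℝ)..1, g s * rlKernel ρ s t) ∂μ01 := by
  have hα : 1 / 2 < ρ + 1 / 2 := by linarith
  have hk := rowBoundedKernel_powExp hα le_rfl
  have h1 : ⟪T g, T g'⟫ =
      ∫ r, (∫ t, powExp (ρ + 1 / 2) 0 (t - r) * g' t ∂μ01) • T g r ∂μ01 := by
    rw [L2.inner_def]
    refine integral_congr_ae ?_
    filter_upwards [hT g'] with r hr
    simp [hr]
  rw [h1, hk.integral_smul_comm g' ((Lp.memLp (T g)).integrable (by norm_num))]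
  refine integral_congr_ae ?_
  filter_upwards [ae_μ01_mem] with t ht
  rw [smul_eq_mul, ← integral_μ01]
  congr 1
  have h2 := hk.integral_smul_comm g ((memLp_powExp_sub_left hα le_rfl ht).integrable (by norm_num))
  calc ∫ r, powExp (ρ + 1 / 2) 0 (t - r) • T g r ∂μ01
      = ∫ r, (∫ s, powExp (ρ + 1 / 2) 0 (s - r) * g s ∂μ01) •
          powExp (ρ + 1 / 2) 0 (t - r) ∂μ01 := by
        refine integral_congr_ae ?_
        filter_upwards [hT g] with r hr
        rw [hr, smul_eq_mul, smul_eq_mul, mul_comm]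
    _ = _ := h2
    _ = ∫ s, g s * rlKernel ρ s t ∂μ01 := by
        refine integral_congr_ae ?_
        filter_upwards [ae_μ01_mem] with s hs
        simp only [smul_eq_mul]
        rw [rlKernel_eq_integral_powExp ρ hs ht]

end VolterraKernel

section TailKernel

variable {α c : ℝ}

theorem one_add_rpow_approx (β : ℝ) : ∃ q ∈ Set.Ioo (0 : ℝ) 1, ∃ C > 0, ∃ a : ℕ → ℝ,
    ∀ z : ℝ, |z| < 1 / 2 → ∀ N : ℕ,
      |(1 + z) ^ β - ∑ l ∈ Finset.range N, a l * z ^ l| ≤ C * q ^ N := by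
  obtain ⟨q, hq, C, hC, h⟩ := (one_add_rpow_hasFPowerSeriesOnBall_zero
    (a := β)).uniform_geometric_approx (r' := 1 / 2) (by
      rw [← ENNReal.coe_one, ENNReal.coe_lt_coe]; exact half_lt_self one_pos)
  refine ⟨q, hq, C, hC, fun l => (binomialSeries ℝ β).coeff l, fun z hz N => ?_⟩
  have h1 := h z (by simpa using hz) N
  rw [zero_add, norm_eq_abs] at h1
  convert h1 using 4
  refine Finset.sum_congr rfl fun l _ => ?_
  simp [mul_comm]

theorem add_rpow_le {x t : ℝ} (hx : 0 ≤ x) (ht : 0 < t) (ht1 : t ≤ 1) :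
    (x + t) ^ (α - 1) ≤ (1 + x) ^ ⌈α⌉₊ * t ^ (-singOrder α) := by
  have h1 : 1 ≤ t ^ (-singOrder α) :=
    one_le_rpow_of_pos_of_le_one_of_nonpos ht ht1 (neg_nonpos.2 singOrder_nonneg)
  have h2 : (1 : ℝ) ≤ (1 + x) ^ ⌈α⌉₊ := one_le_pow₀ (by linarith)
  rcases le_or_gt 1 α with h | h
  · calc (x + t) ^ (α - 1) ≤ (1 + x) ^ (α - 1) :=
          rpow_le_rpow (by positivity) (by linarith) (by linarith)
      _ ≤ (1 + x) ^ (⌈α⌉₊ : ℝ) :=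
          rpow_le_rpow_of_exponent_le (by linarith) (by linarith [Nat.le_ceil α])
      _ = (1 + x) ^ ⌈α⌉₊ := rpow_natCast _ _
      _ ≤ _ := le_mul_of_one_le_right (by positivity) h1
  · calc (x + t) ^ (α - 1) ≤ t ^ (α - 1) :=
          rpow_le_rpow_of_nonpos ht (by linarith) (by linarith)
      _ ≤ t ^ (-singOrder α) := rpow_le_singOrder ht ht1
      _ ≤ _ := le_mul_of_one_le_left (by positivity) h2

theorem powExp_add {x t : ℝ} (hx : 0 ≤ x) (ht : 0 < t) :
    powExp α c (x + t) = exp (-(c * x)) * exp (-(c * t)) * (x + t) ^ (α - 1) := by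
  rw [powExp_of_pos (by positivity), ← exp_add, mul_comm]
  ring_nf

theorem powExp_add_le (hc : 0 ≤ c) {x t : ℝ} (hx : 0 ≤ x) (ht : 0 < t) (ht1 : t ≤ 1) :
    powExp α c (x + t) ≤ (1 + x) ^ ⌈α⌉₊ * exp (-(c * x)) * t ^ (-singOrder α) := by
  rw [powExp_add hx ht]
  have h1 : exp (-(c * t)) ≤ 1 := exp_le_one_iff.2 (by simp; positivity)
  calc exp (-(c * x)) * exp (-(c * t)) * (x + t) ^ (α - 1)
      ≤ exp (-(c * x)) * 1 * ((1 + x) ^ ⌈α⌉₊ * t ^ (-singOrder α)) := by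
        gcongr
        exact add_rpow_le hx ht ht1
    _ = _ := by ring

/-- Monomials centred in, and restricted to, the dyadic interval `(2 ^ (-i - 1), 2 ^ (-i)]`, with an
exponential weight. -/
noncomputable def dyadicMonomial (c : ℝ) (i l : ℕ) : ℝ → ℝ :=
  (Set.Ioc ((1 / 2 : ℝ) ^ (i + 1)) ((1 / 2) ^ i)).indicator
    fun t => exp (-(c * t)) * (t - 3 / 4 * (1 / 2) ^ i) ^ l

theorem eq_of_mem_dyadic {i j : ℕ} {t : ℝ}
    (hi : t ∈ Set.Ioc ((1 / 2 : ℝ) ^ (i + 1)) ((1 / 2) ^ i))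
    (hj : t ∈ Set.Ioc ((1 / 2 : ℝ) ^ (j + 1)) ((1 / 2) ^ j)) : i = j := by
  have h1 : i < j + 1 := (pow_lt_pow_iff_right_of_lt_one₀ (by norm_num) (by norm_num)).1
    (hj.1.trans_le hi.2)
  have h2 : j < i + 1 := (pow_lt_pow_iff_right_of_lt_one₀ (by norm_num) (by norm_num)).1
    (hi.1.trans_le hj.2)
  omega

theorem powExp_dyadic_approx (hα : 1 / 2 < α) (hc : 0 ≤ c) : ∃ q ∈ Set.Ioo (0 : ℝ) 1, ∃ C > 0,
    ∀ (N : ℕ) (x : ℝ), 0 ≤ x → ∃ a : ℕ → ℕ → ℝ, ∀ t ∈ Set.Ioc (0 : ℝ) 1,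
      |powExp α c (x + t) - ∑ i ∈ Finset.range N, ∑ l ∈ Finset.range N,
        a i l * dyadicMonomial c i l t| ≤
      (1 + x) ^ ⌈α⌉₊ * exp (-(c * x)) *
        (C * q ^ N * t ^ (-singOrder α) +
          (Set.Iic ((1 / 2 : ℝ) ^ N)).indicator (fun t => t ^ (-singOrder α)) t) := by
  obtain ⟨q, hq, C, hC, β, hβ⟩ := one_add_rpow_approx (α - 1)
  refine ⟨q, hq, 2 * C, by positivity, fun N x hx =>
    ⟨fun i l => exp (-(c * x)) * ((x + 3 / 4 * (1 / 2) ^ i) ^ (α - 1) *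
      (β l / (x + 3 / 4 * (1 / 2) ^ i) ^ l)), fun t ht => ?_⟩⟩
  have ht0 := ht.1
  have hq0 := hq.1
  obtain ⟨i, hi1, hi2⟩ := exists_nat_pow_near_of_lt_one ht.1 ht.2
    (show (0 : ℝ) < 1 / 2 by norm_num) (by norm_num)
  have hti : t ∈ Set.Ioc ((1 / 2 : ℝ) ^ (i + 1)) ((1 / 2) ^ i) := ⟨hi1, hi2⟩
  have hzero (j l) (hj : j ≠ i) : dyadicMonomial c j l t = 0 :=
    Set.indicator_of_notMem (fun h => hj (eq_of_mem_dyadic h hti)) _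
  rcases lt_or_ge i N with hiN | hiN
  · rw [Finset.sum_eq_single_of_mem i (Finset.mem_range.2 hiN)
      fun j _ hj => Finset.sum_eq_zero fun l _ => by rw [hzero j l hj, mul_zero]]
    have hind : 0 ≤ (Set.Iic ((1 / 2 : ℝ) ^ N)).indicator (fun t => t ^ (-singOrder α)) t :=
      Set.indicator_apply_nonneg fun _ => by positivity
    set p : ℝ := (1 / 2) ^ i
    have hp : 0 < p := by positivity
    have hp1 : p ≤ 1 := pow_le_one₀ (by norm_num) (by norm_num)
    rw [pow_succ] at hi1
    set w : ℝ := x + 3 / 4 * p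
    have hw : 0 < w := by positivity
    set z : ℝ := (t - 3 / 4 * p) / w
    have hz : |z| < 1 / 2 := by
      rw [abs_div, abs_of_pos hw, div_lt_iff₀ hw, abs_lt]
      constructor <;> simp only [w] <;> linarith
    have hxt : x + t = w * (1 + z) := by
      simp only [z, w]
      field_simp
      ring
    have hz1 : 0 ≤ 1 + z := by linarith [(abs_lt.1 hz).1]
    have heq : powExp α c (x + t) - ∑ l ∈ Finset.range N,
        exp (-(c * x)) * (w ^ (α - 1) * (β l / w ^ l)) * dyadicMonomial c i l t =
        exp (-(c * x)) * exp (-(c * t)) * w ^ (α - 1) *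
          ((1 + z) ^ (α - 1) - ∑ l ∈ Finset.range N, β l * z ^ l) := by
      rw [powExp_add hx ht.1, hxt, mul_rpow hw.le hz1, mul_sub, Finset.mul_sum]
      congr 1
      · ring
      · refine Finset.sum_congr rfl fun l _ => ?_
        rw [dyadicMonomial, Set.indicator_of_mem hti,
          show z ^ l = (t - 3 / 4 * p) ^ l / w ^ l from div_pow ..]
        ring
    rw [heq, abs_mul, abs_of_nonneg (by positivity)]
    have hexp : exp (-(c * t)) ≤ 1 := exp_le_one_iff.2 (by simp; positivity)
    have hwle : w ^ (α - 1) ≤ (1 + x) ^ ⌈α⌉₊ * (2 * t ^ (-singOrder α)) := by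
      refine (add_rpow_le hx (by positivity) (by linarith)).trans ?_
      gcongr
      have h34 : 3 / 4 * t ≤ 3 / 4 * p := by linarith
      refine (rpow_le_rpow_of_nonpos (by positivity) h34 (neg_nonpos.2 singOrder_nonneg)).trans ?_
      rw [mul_rpow (by norm_num) ht.1.le]
      gcongr
      calc (3 / 4 : ℝ) ^ (-singOrder α) ≤ (3 / 4) ^ (-1 : ℝ) :=
            rpow_le_rpow_of_exponent_ge (by norm_num) (by norm_num)
              (by linarith [singOrder_lt hα, singOrder_nonneg (α := α)])
        _ ≤ 2 := by rw [rpow_neg_one]; norm_num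
    calc exp (-(c * x)) * exp (-(c * t)) * w ^ (α - 1) *
          |(1 + z) ^ (α - 1) - ∑ l ∈ Finset.range N, β l * z ^ l|
        ≤ exp (-(c * x)) * 1 * ((1 + x) ^ ⌈α⌉₊ * (2 * t ^ (-singOrder α))) * (C * q ^ N) := by
          gcongr
          exact hβ z hz N
      _ = (1 + x) ^ ⌈α⌉₊ * exp (-(c * x)) * (2 * C * q ^ N * t ^ (-singOrder α) + 0) := by ring
      _ ≤ _ := by gcongr
  · rw [Finset.sum_eq_zero fun j hj => Finset.sum_eq_zero fun l _ => by
      rw [hzero j l (by have := Finset.mem_range.1 hj; omega), mul_zero], sub_zero,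
      abs_of_nonneg (powExp_nonneg _)]
    have htN : t ∈ Set.Iic ((1 / 2 : ℝ) ^ N) :=
      hi2.trans (pow_le_pow_of_le_one (by norm_num) (by norm_num) hiN)
    rw [Set.indicator_of_mem htN]
    refine (powExp_add_le hc hx ht.1 ht.2).trans ?_
    gcongr
    exact le_add_of_nonneg_left (by positivity)

end TailKernel

section TailOperator

variable {α c : ℝ}

/-- The contribution of the images `t + 1, t + 2, …` to the periodization of `powExp`. -/
noncomputable def tailKernel (α c r t : ℝ) : ℝ := ∑' n : ℕ, powExp α c (t - r + (n + 1))

/-- Weights dominating the terms of `tailKernel`. -/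
noncomputable def tailWeight (α c : ℝ) (n : ℕ) : ℝ := (2 + n : ℝ) ^ ⌈α⌉₊ * exp (-(c * n))

theorem tailWeight_nonneg (n : ℕ) : 0 ≤ tailWeight α c n := by unfold tailWeight; positivity

theorem summable_tailWeight (hc : 0 < c) : Summable (tailWeight α c) := by
  have h := (summable_nat_add_iff 2).2 (summable_pow_mul_exp_neg_nat_mul ⌈α⌉₊ hc)
  refine (h.mul_right (exp (2 * c))).congr fun n => ?_
  rw [tailWeight, mul_assoc, ← exp_add]
  push_cast
  ring_nf

theorem weight_le_tailWeight (hc : 0 ≤ c) {r : ℝ} (hr : r ∈ Set.Icc (0 : ℝ) 1) (n : ℕ) :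
    (1 + (1 - r + n)) ^ ⌈α⌉₊ * exp (-(c * (1 - r + n))) ≤ tailWeight α c n := by
  have h1 := hr.1
  have h2 := hr.2
  have h3 : 0 ≤ 1 - r + n := by linarith [n.cast_nonneg (α := ℝ)]
  unfold tailWeight
  refine mul_le_mul (pow_le_pow_left₀ (by linarith) (by linarith) _) (exp_le_exp.2 ?_)
    (exp_nonneg _) (by positivity)
  nlinarith

theorem powExp_tail_le (hc : 0 ≤ c) {r t : ℝ} (hr : r ∈ Set.Icc (0 : ℝ) 1)
    (ht : t ∈ Set.Ioc (0 : ℝ) 1) (n : ℕ) :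
    powExp α c (t - r + (n + 1)) ≤ tailWeight α c n * t ^ (-singOrder α) := by
  have ht0 := ht.1
  rw [show t - r + (n + 1) = (1 - r + n) + t by ring]
  refine (powExp_add_le hc (by linarith [n.cast_nonneg (α := ℝ), hr.2]) ht.1 ht.2).trans ?_
  gcongr
  exact weight_le_tailWeight hc hr n

theorem summable_powExp_tail (hc : 0 < c) {r t : ℝ} (hr : r ∈ Set.Icc (0 : ℝ) 1)
    (ht : t ∈ Set.Ioc (0 : ℝ) 1) : Summable fun n : ℕ => powExp α c (t - r + (n + 1)) :=
  ((summable_tailWeight hc).mul_right _).of_nonneg_of_le (fun _ => powExp_nonneg _)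
    fun n => powExp_tail_le hc.le hr ht n

theorem tailKernel_nonneg (r t : ℝ) : 0 ≤ tailKernel α c r t :=
  tsum_nonneg fun _ => powExp_nonneg _

theorem tailKernel_le (hc : 0 < c) {r t : ℝ} (hr : r ∈ Set.Icc (0 : ℝ) 1)
    (ht : t ∈ Set.Ioc (0 : ℝ) 1) :
    tailKernel α c r t ≤ (∑' n, tailWeight α c n) * t ^ (-singOrder α) := by
  rw [← tsum_mul_right]
  exact (summable_powExp_tail hc hr ht).tsum_le_tsum (fun n => powExp_tail_le hc.le hr ht n)
    ((summable_tailWeight hc).mul_right _)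

theorem measurable_tailKernel : Measurable (Function.uncurry (tailKernel α c)) := by
  have h : Function.uncurry (tailKernel α c) = fun p : ℝ × ℝ =>
      (∑' n : ℕ, ENNReal.ofReal (powExp α c (p.2 - p.1 + (n + 1)))).toReal := by
    funext p
    rw [ENNReal.tsum_toReal_eq fun _ => ENNReal.ofReal_ne_top]
    simp [Function.uncurry, tailKernel, ENNReal.toReal_ofReal (powExp_nonneg _)]
  rw [h]
  refine (Measurable.tsum fun n => ENNReal.measurable_ofReal.comp
    (measurable_powExp.comp ?_)).ennreal_toReal
  exact (measurable_snd.sub measurable_fst).add_const _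

theorem ae_μ01_mem_Ioc : ∀ᵐ t ∂μ01, t ∈ Set.Ioc (0 : ℝ) 1 := by
  rw [μ01, ← restrict_Ioc_eq_restrict_Icc]
  exact ae_restrict_mem measurableSet_Ioc

theorem memLp_rpow_singOrder (hα : 1 / 2 < α) :
    MemLp (fun t : ℝ => t ^ (-singOrder α)) 2 μ01 := by
  rw [memLp_two_iff_integrable_sq (by fun_prop), μ01, ← restrict_Ioc_eq_restrict_Icc]
  exact integrableOn_rpow_singOrder hα 1 zero_le_one

theorem memLp_tailKernel (hα : 1 / 2 < α) (hc : 0 < c) {r : ℝ} (hr : r ∈ Set.Icc (0 : ℝ) 1) :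
    MemLp (tailKernel α c r) 2 μ01 := by
  refine (memLp_rpow_singOrder hα).of_le_mul (c := ∑' n, tailWeight α c n)
    (measurable_tailKernel.comp measurable_prodMk_left).aestronglyMeasurable ?_
  filter_upwards [ae_μ01_mem_Ioc] with t ht
  rw [norm_of_nonneg (tailKernel_nonneg _ _), norm_of_nonneg (rpow_nonneg ht.1.le _)]
  exact tailKernel_le hc hr ht

theorem rowBoundedKernel_tailKernel (hα : 1 / 2 < α) (hc : 0 < c) :
    RowBoundedKernel (tailKernel α c)
      √(∫ t, ((∑' n, tailWeight α c n) * t ^ (-singOrder α)) ^ 2 ∂μ01) where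
  measurable := measurable_tailKernel
  memLp r hr := memLp_tailKernel hα hc hr
  bound r hr := by
    refine sqrt_le_sqrt (integral_mono_ae (memLp_tailKernel hα hc hr).integrable_sq
      ((memLp_rpow_singOrder hα).const_mul _).integrable_sq ?_)
    filter_upwards [ae_μ01_mem_Ioc] with t ht
    exact pow_le_pow_left₀ (tailKernel_nonneg _ _) (tailKernel_le hc hr ht) 2

theorem memLp_dyadicMonomial (hc : 0 ≤ c) (i l : ℕ) : MemLp (dyadicMonomial c i l) 2 μ01 := by
  refine MemLp.of_bound (Measurable.aestronglyMeasurable ?_) 1 ?_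
  · exact Measurable.indicator (by fun_prop) measurableSet_Ioc
  · refine Eventually.of_forall fun t => ?_
    by_cases ht : t ∈ Set.Ioc ((1 / 2 : ℝ) ^ (i + 1)) ((1 / 2) ^ i)
    · rw [dyadicMonomial, Set.indicator_of_mem ht, norm_mul, norm_pow]
      have h1 : t ≤ 1 := ht.2.trans (pow_le_one₀ (by norm_num) (by norm_num))
      have h0 : 0 < t := lt_trans (by positivity) ht.1
      have hp : ((1 : ℝ) / 2) ^ i ≤ 1 := pow_le_one₀ (by norm_num) (by norm_num)
      have hp0 : 0 < ((1 : ℝ) / 2) ^ i := by positivity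
      refine mul_le_one₀ ?_ (by positivity) (pow_le_one₀ (norm_nonneg _) ?_)
      · rw [norm_of_nonneg (exp_nonneg _)]
        exact exp_le_one_iff.2 (by simp; positivity)
      · rw [norm_eq_abs, abs_le]
        constructor <;> linarith
    · rw [dyadicMonomial, Set.indicator_of_notMem ht]
      simp

theorem sqrt_integral_indicator_rpow_le (hα : 1 / 2 < α) : ∃ θ ∈ Set.Ioo (0 : ℝ) 1, ∃ D > 0,
    ∀ N : ℕ, √(∫ t, (Set.Iic ((1 / 2 : ℝ) ^ N)).indicator (fun t => t ^ (-singOrder α)) t ^ 2 ∂μ01)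
      ≤ D * θ ^ N := by
  have hb := singOrder_lt hα
  refine ⟨(1 / 2) ^ ((1 - 2 * singOrder α) / 2),
    ⟨by positivity, rpow_lt_one (by norm_num) (by norm_num) (by linarith)⟩,
    √(1 / (1 - 2 * singOrder α)), sqrt_pos.2 (one_div_pos.2 (by linarith)), fun N => ?_⟩
  have hδ : (0 : ℝ) < (1 / 2) ^ N := by positivity
  have hδ1 : ((1 : ℝ) / 2) ^ N ≤ 1 := pow_le_one₀ (by norm_num) (by norm_num)
  have h_int : ∫ t, (Set.Iic ((1 / 2 : ℝ) ^ N)).indicator (fun t => t ^ (-singOrder α)) t ^ 2 ∂μ01 =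
      1 / (1 - 2 * singOrder α) * ((1 / 2 : ℝ) ^ N) ^ (1 - 2 * singOrder α) := by
    have h1 : (fun t => (Set.Iic ((1 / 2 : ℝ) ^ N)).indicator (fun t => t ^ (-singOrder α)) t ^ 2)
        = (Set.Iic ((1 / 2 : ℝ) ^ N)).indicator fun t => (t ^ (-singOrder α)) ^ 2 := by
      funext t
      by_cases ht : t ∈ Set.Iic ((1 / 2 : ℝ) ^ N)
      · rw [Set.indicator_of_mem ht, Set.indicator_of_mem ht]
      · rw [Set.indicator_of_notMem ht, Set.indicator_of_notMem ht]
        norm_num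
    have h2 : Set.Ioc (0 : ℝ) 1 ∩ Set.Iic ((1 / 2 : ℝ) ^ N) = Set.Ioc 0 ((1 / 2) ^ N) := by
      rw [Set.Ioc_inter_Iic, min_eq_right hδ1]
    rw [h1, μ01, ← restrict_Ioc_eq_restrict_Icc, setIntegral_indicator measurableSet_Iic, h2]
    have h3 := integral_rpow (a := 0) (b := (1 / 2) ^ N) (r := -(2 * singOrder α))
      (Or.inl (by linarith))
    rw [intervalIntegral.integral_of_le hδ.le, zero_rpow (by linarith)] at h3
    rw [show 1 - 2 * singOrder α = -(2 * singOrder α) + 1 by ring, one_div_mul_eq_div,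
      ← sub_zero (((1 / 2 : ℝ) ^ N) ^ _), ← h3]
    refine setIntegral_congr_fun measurableSet_Ioc fun t ht => ?_
    rw [← rpow_natCast, ← rpow_mul ht.1.le]
    ring_nf
  rw [h_int, sqrt_mul' _ (by positivity)]
  refine le_of_eq ?_
  congr 1
  rw [sqrt_eq_rpow, ← rpow_mul hδ.le, ← rpow_natCast, ← rpow_mul (by norm_num),
    ← rpow_natCast, ← rpow_mul (by norm_num)]
  ring_nf

/-- On a subspace of codimension `N ^ 2` the tail operator is exponentially small in `N`. -/
theorem tailKernel_lowRank (hα : 1 / 2 < α) (hc : 0 < c) : ∃ θ ∈ Set.Ioo (0 : ℝ) 1, ∃ C > 0,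
    ∀ N : ℕ, ∃ W : Fin N × Fin N → Lp ℝ 2 μ01, ∀ f : Lp ℝ 2 μ01, (∀ i, ⟪W i, f⟫ = 0) →
      ∀ r ∈ Set.Icc (0 : ℝ) 1, |∫ t, tailKernel α c r t * f t ∂μ01| ≤ C * θ ^ N * ‖f‖ := by
  obtain ⟨q, hq, C, hC, happ⟩ := powExp_dyadic_approx hα hc.le
  obtain ⟨η, hη, D, hD, hind⟩ := sqrt_integral_indicator_rpow_le hα
  have hq0 := hq.1
  have hη0 := hη.1
  set E : ℝ := √(∫ t, (t ^ (-singOrder α)) ^ 2 ∂μ01) with hE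
  set A : ℝ := ∑' n, tailWeight α c n with hA
  have hA0 : 0 ≤ A := tsum_nonneg tailWeight_nonneg
  refine ⟨max q η, ⟨lt_max_of_lt_left hq.1, max_lt hq.2 hη.2⟩, (A + 1) * (C * E + D), by positivity,
    fun N => ⟨fun i => (memLp_dyadicMonomial hc.le i.1 i.2).toLp, fun f hf r hr => ?_⟩⟩
  have hψ := memLp_rpow_singOrder hα
  have hψN : MemLp ((Set.Iic ((1 / 2 : ℝ) ^ N)).indicator fun t => t ^ (-singOrder α)) 2 μ01 :=
    hψ.indicator measurableSet_Iic
  have hf' (i l) (hi : i < N) (hl : l < N) : ∫ t, dyadicMonomial c i l t * f t ∂μ01 = 0 := by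
    have h := hf (⟨i, hi⟩, ⟨l, hl⟩)
    rw [L2.inner_def] at h
    rw [← h]
    refine integral_congr_ae ?_
    filter_upwards [(memLp_dyadicMonomial hc.le i l).coeFn_toLp] with t ht
    simp [ht, mul_comm]
  have hmem (n : ℕ) : MemLp (fun t => powExp α c (t - r + (n + 1))) 2 μ01 := by
    refine hψ.of_le_mul (c := tailWeight α c n) (measurable_powExp.comp
      (by fun_prop : Measurable fun t : ℝ => t - r + (n + 1))).aestronglyMeasurable ?_
    filter_upwards [ae_μ01_mem_Ioc] with t ht
    rw [norm_of_nonneg (powExp_nonneg _), norm_of_nonneg (rpow_nonneg ht.1.le _)]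
    exact powExp_tail_le hc.le hr ht n
  have hterm (n : ℕ) : |∫ t, powExp α c (t - r + (n + 1)) * f t ∂μ01| ≤
      tailWeight α c n * ((C * E + D) * max q η ^ N * ‖f‖) := by
    obtain ⟨a, ha⟩ := happ N (1 - r + n) (by linarith [n.cast_nonneg (α := ℝ), hr.2])
    set P : ℝ → ℝ := fun t => ∑ i ∈ Finset.range N, ∑ l ∈ Finset.range N,
      a i l * dyadicMonomial c i l t with hP
    have hPmem : MemLp P 2 μ01 := memLp_finsetSum _ fun i _ => memLp_finsetSum _ fun l _ =>
      (memLp_dyadicMonomial hc.le i l).const_mul _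
    have hP0 : ∫ t, P t * f t ∂μ01 = 0 := by
      simp only [hP, Finset.sum_mul, mul_assoc]
      rw [integral_finsetSum _ fun i _ => integrable_finsetSum _ fun l _ =>
        (integrable_mul_Lp (memLp_dyadicMonomial hc.le i l) f).const_mul _]
      refine Finset.sum_eq_zero fun i hi => ?_
      rw [integral_finsetSum _ fun l _ =>
        (integrable_mul_Lp (memLp_dyadicMonomial hc.le i l) f).const_mul _]
      refine Finset.sum_eq_zero fun l hl => ?_
      rw [integral_const_mul, hf' i l (Finset.mem_range.1 hi) (Finset.mem_range.1 hl), mul_zero]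
    have h1 : ∫ t, powExp α c (t - r + (n + 1)) * f t ∂μ01 =
        ∫ t, (powExp α c (t - r + (n + 1)) - P t) * f t ∂μ01 := by
      simp only [sub_mul]
      rw [integral_sub (integrable_mul_Lp (hmem n) f) (integrable_mul_Lp hPmem f), hP0, sub_zero]
    have hi1 := ((integrable_mul_Lp hψ f).abs.const_mul (C * q ^ N))
    have hi2 := (integrable_mul_Lp hψN f).abs
    have h2 : ∫ t, |(powExp α c (t - r + (n + 1)) - P t) * f t| ∂μ01 ≤
        ∫ t, tailWeight α c n * (C * q ^ N * |t ^ (-singOrder α) * f t| +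
          |(Set.Iic ((1 / 2 : ℝ) ^ N)).indicator (fun t => t ^ (-singOrder α)) t * f t|) ∂μ01 := by
      refine integral_mono_ae (integrable_mul_Lp ((hmem n).sub hPmem) f).abs
        ((hi1.add hi2).const_mul _) ?_
      filter_upwards [ae_μ01_mem_Ioc] with t ht
      have hti : 0 ≤ (Set.Iic ((1 / 2 : ℝ) ^ N)).indicator (fun t => t ^ (-singOrder α)) t :=
        Set.indicator_apply_nonneg fun _ => rpow_nonneg ht.1.le _
      have ht0 : 0 ≤ t ^ (-singOrder α) := rpow_nonneg ht.1.le _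
      have hat := ha t ht
      rw [show 1 - r + n + t = t - r + (n + 1) by ring] at hat
      rw [abs_mul, abs_mul, abs_mul, abs_of_nonneg ht0, abs_of_nonneg hti]
      calc _ ≤ tailWeight α c n * (C * q ^ N * t ^ (-singOrder α) +
              (Set.Iic ((1 / 2 : ℝ) ^ N)).indicator (fun t => t ^ (-singOrder α)) t) * |f t| := by
            gcongr
            refine hat.trans ?_
            gcongr
            exact weight_le_tailWeight hc.le hr n
        _ = _ := by ring
    rw [integral_const_mul, integral_add hi1 hi2, integral_const_mul] at h2
    rw [h1]
    refine (abs_integral_le_integral_abs.trans h2).trans ?_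
    refine mul_le_mul_of_nonneg_left ?_ (tailWeight_nonneg n)
    calc _ ≤ C * q ^ N * (E * ‖f‖) + (D * η ^ N) * ‖f‖ := by
          gcongr
          · exact integral_abs_mul_le hψ f
          · exact (integral_abs_mul_le hψN f).trans (by gcongr; exact hind N)
      _ ≤ C * max q η ^ N * (E * ‖f‖) + (D * max q η ^ N) * ‖f‖ := by
          gcongr
          · exact le_max_left _ _
          · exact le_max_right _ _
      _ = _ := by ring
  have hsum : HasSum (fun n : ℕ => ∫ t, powExp α c (t - r + (n + 1)) * f t ∂μ01)
      (∫ t, tailKernel α c r t * f t ∂μ01) := by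
    have h := hasSum_integral_of_summable_integral_norm (μ := μ01)
      (F := fun (n : ℕ) t => powExp α c (t - r + (n + 1)) * f t)
      (fun n => integrable_mul_Lp (hmem n) f) ?_
    · simpa only [tailKernel, tsum_mul_right] using h
    · refine ((summable_tailWeight (α := α) hc).mul_right (E * ‖f‖)).of_nonneg_of_le
        (fun n => integral_nonneg fun _ => norm_nonneg _) fun n => ?_
      calc _ ≤ ∫ t, tailWeight α c n * |t ^ (-singOrder α) * f t| ∂μ01 := by
            refine integral_mono_ae (integrable_mul_Lp (hmem n) f).norm
              ((integrable_mul_Lp hψ f).abs.const_mul _) ?_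
            filter_upwards [ae_μ01_mem_Ioc] with t ht
            rw [norm_mul, abs_mul, abs_of_nonneg (rpow_nonneg ht.1.le _), ← mul_assoc,
              norm_of_nonneg (powExp_nonneg _), norm_eq_abs]
            gcongr
            exact powExp_tail_le hc.le hr ht n
        _ ≤ _ := by
            rw [integral_const_mul]
            exact mul_le_mul_of_nonneg_left (integral_abs_mul_le hψ f) (tailWeight_nonneg n)
  rw [← hsum.tsum_eq, ← norm_eq_abs]
  refine (tsum_of_norm_bounded ((summable_tailWeight (α := α) hc).hasSum.mul_right _)
    hterm).trans ?_
  rw [← hA]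
  have : 0 < max q η := lt_max_of_lt_left hq0
  calc A * ((C * E + D) * max q η ^ N * ‖f‖)
      ≤ (A + 1) * ((C * E + D) * max q η ^ N * ‖f‖) := by gcongr; linarith
    _ = _ := by ring

end TailOperator

section LaplaceTransform

variable {α c : ℝ}

theorem integrableOn_rpow_mul_exp_neg (hα : 0 < α) (hc : 0 < c) :
    IntegrableOn (fun x : ℝ => x ^ (α - 1) * exp (-(c * x))) (Set.Ioi 0) := by
  have h := integrableOn_rpow_mul_exp_neg_mul_rpow (p := 1) (s := α - 1) (by linarith) one_pos hc
  simpa [neg_mul] using h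

/-- The Laplace transform of `x ^ (α - 1)` in the left half plane. -/
theorem integral_rpow_smul_cexp (hα : 0 < α) {z : ℂ} (hz : z.re < 0) :
    ∫ x in Set.Ioi (0 : ℝ), (x ^ (α - 1)) • Complex.exp (z * x) =
      (Gamma α : ℂ) * (-z) ^ (-(α : ℂ)) := by
  set ν : Measure ℝ := (volume.restrict (Set.Ioi 0)).withDensity
    fun x => ENNReal.ofReal (x ^ (α - 1)) with hν
  have hm : Measurable fun x : ℝ => ENNReal.ofReal (x ^ (α - 1)) := by fun_prop
  have hcongr {E : Type} [NormedAddCommGroup E] [NormedSpace ℝ E] (g : ℝ → E) :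
      Set.EqOn (fun x : ℝ => (ENNReal.ofReal (x ^ (α - 1))).toReal • g x)
        (fun x => x ^ (α - 1) • g x) (Set.Ioi 0) := fun x hx => by
    simp only [ENNReal.toReal_ofReal (rpow_nonneg (le_of_lt hx) _)]
  have h_int {E : Type} [NormedAddCommGroup E] [NormedSpace ℝ E] (g : ℝ → E) :
      ∫ x, g x ∂ν = ∫ x in Set.Ioi (0 : ℝ), x ^ (α - 1) • g x := by
    rw [hν, integral_withDensity_eq_integral_toReal_smul hm (by simp)]
    exact setIntegral_congr_fun measurableSet_Ioi (hcongr g)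
  have hsub : Set.Iio 0 ⊆ interior (integrableExpSet id ν) := by
    refine interior_maximal (fun t ht => ?_) isOpen_Iio
    rw [integrableExpSet, Set.mem_ofPred_eq, hν,
      integrable_withDensity_iff_integrable_smul₀' hm.aemeasurable (by simp)]
    refine (integrableOn_congr_fun (hcongr _) measurableSet_Ioi).2 ?_
    simpa using integrableOn_rpow_mul_exp_neg hα (neg_pos.2 ht)
  have hL : AnalyticOnNhd ℂ (complexMGF id ν) {z | z.re < 0} :=
    analyticOnNhd_complexMGF.mono fun z hz => hsub hz
  have hopen : IsOpen {z : ℂ | z.re < 0} := isOpen_lt Complex.continuous_re continuous_const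
  have hR : AnalyticOnNhd ℂ (fun z : ℂ => (Gamma α : ℂ) * (-z) ^ (-(α : ℂ))) {z | z.re < 0} := by
    refine DifferentiableOn.analyticOnNhd (fun z hz => ?_) hopen
    refine (DifferentiableAt.const_mul ?_ _).differentiableWithinAt
    exact differentiableAt_id.neg.cpow_const (Or.inl (by simpa using hz))
  have hconn : IsPreconnected {z : ℂ | z.re < 0} :=
    ((convex_Iio (0 : ℝ)).linear_preimage Complex.reLm).isPreconnected
  have hreal (t : ℝ) (ht : t < 0) :
      complexMGF id ν t = (Gamma α : ℂ) * (-(t : ℂ)) ^ (-(α : ℂ)) := by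
    rw [complexMGF_ofReal, mgf, h_int]
    have h := integral_rpow_mul_exp_neg_mul_Ioi hα (neg_pos.2 ht)
    simp only [neg_mul, neg_neg] at h
    simp only [id, smul_eq_mul]
    rw [h, one_div, inv_rpow (by linarith), ← rpow_neg (by linarith), mul_comm,
      Complex.ofReal_mul, Complex.ofReal_cpow (by linarith)]
    simp
  have heq := hL.eqOn_of_preconnected_of_frequently_eq hR hconn (z₀ := ((-1 : ℝ) : ℂ))
    (by simp) ?_
  · have h := heq (show z ∈ {z : ℂ | z.re < 0} from hz)
    rw [complexMGF, h_int] at h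
    exact h
  · have h : ∃ᶠ x : ℝ in nhdsWithin (-1) {-1}ᶜ,
        complexMGF id ν x = (Gamma α : ℂ) * (-(x : ℂ)) ^ (-(α : ℂ)) := by
      refine Eventually.frequently (Eventually.filter_mono nhdsWithin_le_nhds ?_)
      filter_upwards [gt_mem_nhds (show (-1 : ℝ) < 0 by norm_num)] with x hx using hreal x hx
    rw [frequently_iff_seq_forall] at h ⊢
    obtain ⟨xs, hx, hx_eq⟩ := h
    refine ⟨fun n => xs n, ?_, hx_eq⟩
    rw [tendsto_nhdsWithin_iff] at hx ⊢
    refine ⟨(Complex.continuous_ofReal.tendsto _).comp hx.1, hx.2.mono fun n hn => ?_⟩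
    simpa [Complex.ext_iff] using hn

theorem integrable_powExp (hα : 0 < α) (hc : 0 < c) : Integrable (powExp α c) := by
  have h : powExp α c = (Set.Ioi 0).indicator fun x => x ^ (α - 1) * exp (-(c * x)) := by
    funext x
    simp [powExp, Set.indicator_apply]
  rw [h, integrable_indicator_iff measurableSet_Ioi]
  exact integrableOn_rpow_mul_exp_neg hα hc

/-- The modulus of the Fourier transform of `powExp`. -/
theorem norm_integral_powExp_smul_cexp (hα : 0 < α) (hc : 0 < c) (ω : ℝ) :
    ‖∫ x, powExp α c x • Complex.exp (ω * x * Complex.I)‖ =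
      Gamma α * (c ^ 2 + ω ^ 2) ^ (-(α / 2)) := by
  have h : ∫ x, powExp α c x • Complex.exp (ω * x * Complex.I) =
      ∫ x in Set.Ioi (0 : ℝ), (x ^ (α - 1)) • Complex.exp ((-c + ω * Complex.I) * x) := by
    rw [← integral_indicator measurableSet_Ioi]
    congr 1
    funext x
    by_cases hx : 0 < x
    · rw [Set.indicator_of_mem (show x ∈ Set.Ioi 0 from hx), powExp_of_pos hx]
      simp only [Complex.real_smul, Complex.ofReal_mul, Complex.ofReal_exp, mul_assoc,
        ← Complex.exp_add]
      congr 2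
      push_cast
      ring
    · rw [Set.indicator_of_notMem (by simpa using hx), powExp_of_nonpos (not_lt.1 hx), zero_smul]
  rw [h, integral_rpow_smul_cexp hα (by simpa using hc), norm_mul,
    ← Complex.ofReal_neg α, Complex.norm_cpow_real, Complex.norm_real,
    norm_of_nonneg (Gamma_pos_of_pos hα).le,
    Complex.norm_def, sqrt_eq_rpow, ← rpow_mul (Complex.normSq_nonneg _), Complex.normSq_apply]
  congr 2
  · simp [sq]
  · ring

end LaplaceTransform

section Multiplier

variable {α c : ℝ}

theorem hasSum_integral_translates {E : Type*} [NormedAddCommGroup E] [NormedSpace ℝ E]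
    {G : ℝ → E} (hG : Integrable G) (hG0 : ∀ x ≤ 0, G x = 0) {t : ℝ} (ht : t ≤ 1) :
    HasSum (fun n : ℕ => ∫ r, G (t - r + n) ∂μ01) (∫ x, G x) := by
  have h := hG.hasSum_intervalIntegral (t - 1)
  rw [← (Nat.cast_injective (R := ℤ)).hasSum_iff] at h
  · convert h using 2 with n
    rw [integral_μ01]
    have h1 := intervalIntegral.integral_comp_sub_left (a := 0) (b := 1) G (t + n)
    rw [show t + n - 1 = t - 1 + n by ring, show t + n - 0 = t - 1 + n + 1 by ring] at h1
    simpa [add_sub_right_comm] using h1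
  · intro n hn
    have hn0 : n ≤ -1 := by
      by_contra! h0
      exact hn ⟨n.toNat, by simp; omega⟩
    have hn0' : (n : ℝ) ≤ -1 := by exact_mod_cast hn0
    refine (intervalIntegral.integral_congr fun x hx => ?_).trans intervalIntegral.integral_zero
    rw [Set.uIcc_of_le (by linarith)] at hx
    exact hG0 x (by linarith [hx.2])

/-- The character `r ↦ exp (-2 π i k r)`. -/
noncomputable def expChar (k : ℤ) (r : ℝ) : ℂ := Complex.exp ((-(2 * π * k * r) : ℝ) * Complex.I)

theorem expChar_add (k : ℤ) (r s : ℝ) : expChar k (r + s) = expChar k r * expChar k s := by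
  simp only [expChar, ← Complex.exp_add]
  push_cast
  ring_nf

theorem expChar_natCast (k : ℤ) (n : ℕ) : expChar k n = 1 := by
  rw [expChar, ← Complex.exp_int_mul_two_pi_mul_I (-k * n)]
  push_cast
  ring_nf

theorem norm_expChar (k : ℤ) (r : ℝ) : ‖expChar k r‖ = 1 := Complex.norm_exp_ofReal_mul_I _

theorem continuous_expChar (k : ℤ) : Continuous (expChar k) := by
  unfold expChar
  fun_prop

theorem memLp_expChar (k : ℤ) : MemLp (expChar k) 2 μ01 :=
  MemLp.of_bound (continuous_expChar k).aestronglyMeasurable 1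
    (Eventually.of_forall fun r => (norm_expChar k r).le)

/-- The Fourier multiplier of convolution with `powExp` on the circle. -/
noncomputable def powExpMultiplier (α c : ℝ) (k : ℤ) : ℂ := ∫ x, powExp α c x • expChar k (-x)

theorem norm_powExpMultiplier (hα : 0 < α) (hc : 0 < c) (k : ℤ) :
    ‖powExpMultiplier α c k‖ = Gamma α * (c ^ 2 + (2 * π * k) ^ 2) ^ (-(α / 2)) := by
  rw [← norm_integral_powExp_smul_cexp hα hc, powExpMultiplier]
  simp [expChar]

/-- The kernel of convolution with `powExp` on the circle. -/
noncomputable def periodicKernel (α c r t : ℝ) : ℝ := powExp α c (t - r) + tailKernel α c r t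

theorem integral_periodicKernel_smul_expChar (hα : 0 < α) (hc : 0 < c) (k : ℤ) {t : ℝ}
    (ht : t ∈ Set.Ioc (0 : ℝ) 1) :
    ∫ r, periodicKernel α c r t • expChar k r ∂μ01 = powExpMultiplier α c k * expChar k t := by
  set G : ℝ → ℂ := fun x => powExp α c x • expChar k (-x) with hG
  have hGi : Integrable G := by
    refine (integrable_powExp hα hc).norm.mono'
      (measurable_powExp.aestronglyMeasurable.smul
        ((continuous_expChar k).comp continuous_neg).aestronglyMeasurable) ?_
    exact Eventually.of_forall fun x => by rw [norm_smul, norm_expChar, mul_one]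
  have hG0 (x : ℝ) (hx : x ≤ 0) : G x = 0 := by rw [hG]; simp [powExp_of_nonpos hx]
  have hGt (r : ℝ) (n : ℕ) :
      G (t - r + n) * expChar k t = powExp α c (t - r + n) • expChar k r := by
    have h1 : expChar k (-(t - r + n)) * expChar k t * expChar k n = expChar k r := by
      rw [← expChar_add, ← expChar_add]
      ring_nf
    rw [expChar_natCast, mul_one] at h1
    rw [hG, smul_mul_assoc, h1]
  have hsum := hasSum_integral_of_summable_integral_norm (μ := μ01)
    (F := fun (n : ℕ) r => G (t - r + n)) (fun n => ?_)
    (hasSum_integral_translates hGi.norm (fun x hx => by rw [hG0 x hx, norm_zero]) ht.2).summable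
  · have h := hsum.unique (hasSum_integral_translates hGi hG0 ht.2)
    rw [powExpMultiplier, ← hG, ← h, ← integral_mul_const]
    refine integral_congr_ae ?_
    filter_upwards [ae_μ01_mem] with r hr
    rw [← tsum_mul_right]
    simp_rw [hGt]
    have hs : Summable fun n : ℕ => powExp α c (t - r + n) :=
      (summable_nat_add_iff 1).1 (by simpa using summable_powExp_tail hc hr ht)
    rw [hs.tsum_smul_const, hs.tsum_eq_zero_add]
    simp [periodicKernel, tailKernel]
  · rw [μ01]
    have : Integrable (fun r => G (t - r + n)) := by
      have := hGi.comp_sub_left (t + n)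
      refine this.congr (Eventually.of_forall fun r => ?_)
      simp only
      ring_nf
    exact this.restrict

theorem RowBoundedKernel.add {k₁ k₂ : ℝ → ℝ → ℝ} {M₁ M₂ : ℝ} (h₁ : RowBoundedKernel k₁ M₁)
    (h₂ : RowBoundedKernel k₂ M₂) : RowBoundedKernel (fun r t => k₁ r t + k₂ r t) (M₁ + M₂) where
  measurable := h₁.measurable.add h₂.measurable
  memLp r hr := (h₁.memLp r hr).add (h₂.memLp r hr)
  bound r hr := by
    have h := norm_add_le (h₁.memLp r hr).toLp (h₂.memLp r hr).toLp
    rw [← MemLp.toLp_add, norm_toLp_μ01, norm_toLp_μ01, norm_toLp_μ01] at h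
    exact h.trans (add_le_add (h₁.bound r hr) (h₂.bound r hr))

/-- Fourier coefficients of a function on `[0,1]`. -/
noncomputable def fourierInt (f : Lp ℝ 2 μ01) (k : ℤ) : ℂ := ∫ t, f t • expChar k t ∂μ01

theorem integrable_smul_expChar (f : Lp ℝ 2 μ01) (k : ℤ) :
    Integrable (fun t => f t • expChar k t) μ01 := by
  refine ((Lp.memLp f).integrable one_le_two).norm.mono' ((Lp.aestronglyMeasurable f).smul
    (continuous_expChar k).aestronglyMeasurable) (Eventually.of_forall fun t => ?_)
  rw [norm_smul, norm_expChar, mul_one]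

theorem hasSum_sq_fourierInt (f : Lp ℝ 2 μ01) :
    HasSum (fun k => ‖fourierInt f k‖ ^ 2) (‖f‖ ^ 2) := by
  have hL2 : MemLp (fun t => (f t : ℂ)) 2 (volume.restrict (Set.Ioc 0 1)) := by
    rw [restrict_Ioc_eq_restrict_Icc]
    exact (Lp.memLp f).ofReal (K := ℂ)
  have h := hasSum_sq_fourierCoeffOn (zero_lt_one (α := ℝ)) hL2
  convert h using 1
  · funext k
    rw [fourierCoeffOn_eq_integral, fourierInt, integral_μ01]
    rw [show (1 : ℝ) / (1 - 0) = 1 by norm_num, one_smul]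
    refine congrArg (fun z : ℂ => ‖z‖ ^ 2) ?_
    simp only [fourier_coe_apply, expChar, smul_eq_mul, Complex.real_smul]
    refine intervalIntegral.integral_congr fun t _ => ?_
    rw [mul_comm]
    push_cast
    ring_nf
  · rw [norm_sq_Lp_μ01, integral_μ01]
    simp

theorem fourierInt_of_periodicKernel (hα : 1 / 2 < α) (hc : 0 < c) {f g : Lp ℝ 2 μ01}
    (hg : g =ᵐ[μ01] fun r => ∫ t, periodicKernel α c r t * f t ∂μ01) (k : ℤ) :
    fourierInt g k = powExpMultiplier α c k * fourierInt f k := by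
  have hK : RowBoundedKernel (periodicKernel α c) _ :=
    (rowBoundedKernel_powExp hα hc.le).add (rowBoundedKernel_tailKernel hα hc)
  have h := hK.integral_smul_comm f (y := expChar k) 
    ((memLp_expChar k).integrable one_le_two : Integrable (expChar k) μ01)
  rw [fourierInt, fourierInt, ← integral_const_mul]
  have hgk : ∫ r, g r • expChar k r ∂μ01 =
      ∫ r, (∫ t, periodicKernel α c r t * f t ∂μ01) • expChar k r ∂μ01 :=
    integral_congr_ae (hg.mono fun r hr => by simp only [hr])
  rw [hgk, h]
  refine integral_congr_ae ?_
  filter_upwards [ae_μ01_mem_Ioc] with t ht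
  rw [integral_periodicKernel_smul_expChar (by linarith) hc k ht, mul_smul_comm]

end Multiplier

section HartleyBasis

/-- The function `cos (2 π k t) + sin (2 π k t)`. -/
noncomputable def cas (k : ℤ) (t : ℝ) : ℝ := cos (2 * π * k * t) + sin (2 * π * k * t)

theorem memLp_cas (k : ℤ) : MemLp (cas k) 2 μ01 := by
  refine MemLp.of_bound (C := 2) (by unfold cas; fun_prop) (Eventually.of_forall fun t => ?_)
  exact (norm_add_le _ _).trans ((add_le_add (abs_cos_le_one _) (abs_sin_le_one _)).trans
    (by norm_num))

/-- The Hartley basis of `L²([0,1])`. -/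
noncomputable def casLp (k : ℤ) : Lp ℝ 2 μ01 := (memLp_cas k).toLp

theorem inner_casLp (k : ℤ) (f : Lp ℝ 2 μ01) :
    ⟪casLp k, f⟫ = (fourierInt f k).re - (fourierInt f k).im := by
  have hi := integrable_smul_expChar f k
  have hre : (fourierInt f k).re = ∫ t, (f t • expChar k t).re ∂μ01 := (integral_re hi).symm
  have him : (fourierInt f k).im = ∫ t, (f t • expChar k t).im ∂μ01 := (integral_im hi).symm
  rw [hre, him, L2.inner_def]
  refine Eq.trans ?_ (integral_sub hi.re hi.im)
  refine integral_congr_ae ((memLp_cas k).coeFn_toLp.mono fun t ht => ?_)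
  simp only [casLp, ht]
  have hcos : (expChar k t).re = cos (2 * π * k * t) := by
    rw [expChar, Complex.exp_ofReal_mul_I_re, cos_neg]
  have hsin : (expChar k t).im = -sin (2 * π * k * t) := by
    rw [expChar, Complex.exp_ofReal_mul_I_im, sin_neg]
  simp [cas, hcos, hsin]
  ring

theorem fourierInt_neg (f : Lp ℝ 2 μ01) (k : ℤ) :
    fourierInt f (-k) = (starRingEnd ℂ) (fourierInt f k) := by
  rw [fourierInt, fourierInt, ← integral_conj]
  congr 1
  funext t
  simp only [Complex.real_smul, map_mul, Complex.conj_ofReal, expChar, ← Complex.exp_conj,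
    Complex.conj_I]
  push_cast
  ring_nf

theorem fourierInt_eq_zero {f : Lp ℝ 2 μ01} {k : ℤ} (h : ⟪casLp k, f⟫ = 0)
    (h' : ⟪casLp (-k), f⟫ = 0) : fourierInt f k = 0 := by
  rw [inner_casLp] at h h'
  rw [fourierInt_neg, Complex.conj_re, Complex.conj_im] at h'
  apply Complex.ext <;> simp <;> linarith

theorem integral_cos_sin_two_pi (n : ℤ) :
    ∫ t in (0 : ℝ)..1, cos (2 * π * n * t) = (if n = 0 then 1 else 0) ∧
    ∫ t in (0 : ℝ)..1, sin (2 * π * n * t) = 0 := by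
  rcases eq_or_ne n 0 with rfl | hn
  · simp
  · have h : (2 * π * n : ℝ) ≠ 0 := by
      have : (n : ℝ) ≠ 0 := by exact_mod_cast hn
      positivity
    have hs : sin (2 * π * n) = 0 := by rw [sin_eq_zero_iff]; exact ⟨2 * n, by push_cast; ring⟩
    have hc : cos (2 * π * n) = 1 := by rw [cos_eq_one_iff]; exact ⟨n, by ring⟩
    rw [intervalIntegral.integral_comp_mul_left _ h, intervalIntegral.integral_comp_mul_left _ h]
    simp [hs, hc, hn]

theorem orthonormal_casLp : Orthonormal ℝ casLp := by
  rw [orthonormal_iff_ite]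
  intro k l
  have h : ⟪casLp k, casLp l⟫ = ∫ t, cas k t * cas l t ∂μ01 := by
    rw [L2.inner_def]
    refine integral_congr_ae ?_
    filter_upwards [(memLp_cas k).coeFn_toLp, (memLp_cas l).coeFn_toLp] with t hk hl
    simp [casLp, hk, hl, mul_comm]
  have h2 (t : ℝ) : cas k t * cas l t =
      cos (2 * π * (k - l : ℤ) * t) + sin (2 * π * (k + l : ℤ) * t) := by
    push_cast
    rw [show 2 * π * ((k : ℝ) - l) * t = 2 * π * k * t - 2 * π * l * t by ring,
      show 2 * π * ((k : ℝ) + l) * t = 2 * π * k * t + 2 * π * l * t by ring, cos_sub, sin_add]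
    unfold cas
    ring
  rw [h, integral_μ01]
  simp_rw [h2]
  rw [intervalIntegral.integral_add (by apply Continuous.intervalIntegrable; fun_prop)
    (by apply Continuous.intervalIntegrable; fun_prop), (integral_cos_sin_two_pi _).1,
    (integral_cos_sin_two_pi _).2]
  simp [sub_eq_zero]

end HartleyBasis

section PeriodicOperator

variable {α c : ℝ}

/-- The singular values of convolution with `powExp` on the circle. -/
noncomputable def circleSingularValue (α c x : ℝ) : ℝ :=
  Gamma α * (c ^ 2 + (2 * π * x) ^ 2) ^ (-(α / 2))

theorem circleSingularValue_pos (hα : 0 < α) (hc : 0 < c) (x : ℝ) :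
    0 < circleSingularValue α c x := by
  have := Gamma_pos_of_pos hα
  unfold circleSingularValue
  positivity

theorem circleSingularValue_anti (hα : 0 < α) (hc : 0 < c) {x y : ℝ} (h : |x| ≤ |y|) :
    circleSingularValue α c y ≤ circleSingularValue α c x := by
  have h1 := Gamma_pos_of_pos hα
  have h2 : (2 * π * x) ^ 2 ≤ (2 * π * y) ^ 2 := by
    rw [mul_pow, mul_pow _ y]
    exact mul_le_mul_of_nonneg_left (sq_le_sq.2 h) (sq_nonneg _)
  unfold circleSingularValue
  refine mul_le_mul_of_nonneg_left ?_ h1.le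
  exact rpow_le_rpow_of_nonpos (by positivity) (by linarith) (by linarith)

theorem norm_periodic_le (hα : 1 / 2 < α) (hc : 0 < c) {f g : Lp ℝ 2 μ01}
    (hg : g =ᵐ[μ01] fun r => ∫ t, periodicKernel α c r t * f t ∂μ01) {K : ℕ}
    (hf : ∀ k ∈ Finset.Icc (-K : ℤ) K, ⟪casLp k, f⟫ = 0) :
    ‖g‖ ≤ circleSingularValue α c K * ‖f‖ := by
  have hb := circleSingularValue_pos (by linarith : 0 < α) hc K
  rw [← abs_of_nonneg (norm_nonneg g), ← abs_of_nonneg (by positivity : 0 ≤ _ * ‖f‖), ← sq_le_sq,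
    mul_pow]
  refine hasSum_le (fun k => ?_) (hasSum_sq_fourierInt g) ((hasSum_sq_fourierInt f).mul_left _)
  rw [fourierInt_of_periodicKernel hα hc hg, norm_mul, mul_pow]
  by_cases hk : k ∈ Finset.Icc (-K : ℤ) K
  · rw [fourierInt_eq_zero (hf k hk) (hf _ (by simp at hk ⊢; omega))]
    simp
  · gcongr
    rw [norm_powExpMultiplier (by linarith) hc]
    refine circleSingularValue_anti (by linarith) hc ?_
    have : (K : ℤ) ≤ |k| := by
      by_contra! h
      exact hk (Finset.mem_Icc.2 (abs_le.1 h.le))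
    rw [Nat.abs_cast]
    exact_mod_cast this

theorem le_norm_periodic (hα : 1 / 2 < α) (hc : 0 < c) {f g : Lp ℝ 2 μ01}
    (hg : g =ᵐ[μ01] fun r => ∫ t, periodicKernel α c r t * f t ∂μ01) {K : ℕ}
    (hf : ∀ k ∉ Finset.Icc (-K : ℤ) K, ⟪casLp k, f⟫ = 0) :
    circleSingularValue α c K * ‖f‖ ≤ ‖g‖ := by
  have hb := circleSingularValue_pos (by linarith : 0 < α) hc K
  rw [← abs_of_nonneg (norm_nonneg g), ← abs_of_nonneg (by positivity : 0 ≤ _ * ‖f‖), ← sq_le_sq,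
    mul_pow]
  refine hasSum_le (fun k => ?_) ((hasSum_sq_fourierInt f).mul_left _) (hasSum_sq_fourierInt g)
  rw [fourierInt_of_periodicKernel hα hc hg, norm_mul, mul_pow]
  by_cases hk : k ∈ Finset.Icc (-K : ℤ) K
  · gcongr
    rw [norm_powExpMultiplier (by linarith) hc]
    refine circleSingularValue_anti (by linarith) hc ?_
    have : |k| ≤ K := abs_le.2 (Finset.mem_Icc.1 hk)
    rw [Nat.abs_cast]
    exact_mod_cast this
  · rw [fourierInt_eq_zero (hf k hk) (hf _ (by simp at hk ⊢; omega))]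
    simp

end PeriodicOperator

section VolterraBounds

variable {α c ε : ℝ} {N : ℕ} {T : Lp ℝ 2 μ01 →L[ℝ] Lp ℝ 2 μ01}

theorem real_inner_mulOperator {φ : ℝ → ℝ} {S : Lp ℝ 2 μ01 →L[ℝ] Lp ℝ 2 μ01}
    (hS : ∀ g, S g =ᵐ[μ01] fun t => φ t * g t) (f g : Lp ℝ 2 μ01) : ⟪S f, g⟫ = ⟪f, S g⟫ := by
  rw [L2.inner_def, L2.inner_def]
  refine integral_congr_ae ?_
  filter_upwards [hS f, hS g] with t hf hg
  simp [hf, hg]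
  ring

/-- Comparison of the Volterra operator with its exponentially damped version, as operators in
`f t = exp (c t) g t`. -/
theorem exists_comparison (hα : 1 / 2 < α) (hc : 0 < c)
    (hT : ∀ g, T g =ᵐ[μ01] fun r => ∫ t, powExp α 0 (t - r) * g t ∂μ01) :
    ∃ S S' A H : Lp ℝ 2 μ01 →L[ℝ] Lp ℝ 2 μ01,
      (∀ f g, ⟪S f, g⟫ = ⟪f, S g⟫) ∧ (∀ g, S (S' g) = g) ∧ (∀ g, ‖g‖ ≤ ‖S g‖) ∧
      (∀ g, ‖S g‖ ≤ exp c * ‖g‖) ∧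
      (∀ f, A f =ᵐ[μ01] fun r => ∫ t, periodicKernel α c r t * f t ∂μ01) ∧
      (∀ f, H f =ᵐ[μ01] fun r => ∫ t, tailKernel α c r t * f t ∂μ01) ∧
      (∀ g, ‖T g‖ ≤ ‖A (S g) - H (S g)‖) ∧
      ∀ g, exp (-c) * ‖A (S g) - H (S g)‖ ≤ ‖T g‖ := by
  have hk₁ := rowBoundedKernel_powExp hα hc.le
  have hk₂ := rowBoundedKernel_tailKernel hα hc
  obtain ⟨A, hA⟩ := (hk₁.add hk₂).exists_operator
  obtain ⟨H, hH⟩ := hk₂.exists_operator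
  have hbd {x : ℝ} (hx : x ≤ c) : |exp x| ≤ exp c := by
    rw [abs_of_pos (exp_pos _)]
    exact exp_le_exp.2 hx
  obtain ⟨S, hS⟩ := exists_mulOperator (φ := fun t => exp (c * t)) (by fun_prop) (M := exp c)
    fun t ht => hbd (by nlinarith [ht.1, ht.2])
  obtain ⟨S', hS'⟩ := exists_mulOperator (φ := fun t => exp (-(c * t))) (by fun_prop) (M := exp c)
    fun t ht => hbd (by nlinarith [ht.1, ht.2])
  have hTS (g : Lp ℝ 2 μ01) : T g =ᵐ[μ01] fun r => exp (-(c * r)) * (A (S g) - H (S g)) r := by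
    filter_upwards [hT g, hA (S g), hH (S g), Lp.coeFn_sub (A (S g)) (H (S g)), ae_μ01_mem]
      with r h₁ h₂ h₃ h₄ hr
    rw [h₁, h₄, Pi.sub_apply, h₂, h₃]
    simp only [add_mul]
    rw [integral_add (integrable_mul_Lp (hk₁.memLp r hr) _)
      (integrable_mul_Lp (hk₂.memLp r hr) _), add_sub_cancel_right, ← integral_const_mul]
    refine integral_congr_ae ((hS g).mono fun t ht => ?_)
    simp only [ht]
    by_cases htr : 0 < t - r
    · rw [powExp_of_pos htr, powExp_of_pos htr]
      have : exp (-(c * r)) * exp (-(c * (t - r))) * exp (c * t) = 1 := by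
        rw [← exp_add, ← exp_add]
        simp
        ring
      simp only [zero_mul, neg_zero, exp_zero, mul_one]
      linear_combination (-(t - r) ^ (α - 1) * g t) * this
    · rw [powExp_of_nonpos (not_lt.1 htr), powExp_of_nonpos (not_lt.1 htr)]
      simp
  refine ⟨S, S', A, H, real_inner_mulOperator hS, fun g => Lp.ext ?_, fun g => ?_, fun g => ?_,
    hA, hH, fun g => ?_, fun g => ?_⟩
  · filter_upwards [hS (S' g), hS' g] with t h₁ h₂
    rw [h₁, h₂, ← mul_assoc, ← exp_add, add_neg_cancel, exp_zero, one_mul]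
  · refine Lp.norm_le_norm_of_ae_le ?_
    filter_upwards [hS g, ae_μ01_mem] with t h₁ ht
    rw [h₁, norm_mul, norm_of_nonneg (exp_nonneg _)]
    exact le_mul_of_one_le_left (norm_nonneg _) (one_le_exp (mul_nonneg hc.le ht.1))
  · refine Lp.norm_le_mul_norm_of_ae_le_mul ?_
    filter_upwards [hS g, ae_μ01_mem] with t h₁ ht
    rw [h₁, norm_mul, norm_of_nonneg (exp_nonneg _)]
    gcongr
    nlinarith [ht.2]
  · refine Lp.norm_le_norm_of_ae_le ?_
    filter_upwards [hTS g, ae_μ01_mem] with t h₁ ht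
    rw [h₁, norm_mul, norm_of_nonneg (exp_nonneg _)]
    exact mul_le_of_le_one_left (norm_nonneg _)
      (exp_le_one_iff.2 (neg_nonpos.2 (mul_nonneg hc.le ht.1)))
  · rw [← le_div_iff₀' (exp_pos _), exp_neg, div_inv_eq_mul, mul_comm]
    refine Lp.norm_le_mul_norm_of_ae_le_mul ?_
    filter_upwards [hTS g, ae_μ01_mem] with t h₁ ht
    rw [h₁, norm_mul, norm_of_nonneg (exp_nonneg _), ← mul_assoc, ← exp_add]
    exact le_mul_of_one_le_left (norm_nonneg _) (one_le_exp (by nlinarith [ht.2]))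

theorem volterra_upper (hα : 1 / 2 < α) (hc : 0 < c)
    (hT : ∀ g, T g =ᵐ[μ01] fun r => ∫ t, powExp α 0 (t - r) * g t ∂μ01)
    {W : Fin N × Fin N → Lp ℝ 2 μ01} (hε : 0 ≤ ε)
    (hW : ∀ f : Lp ℝ 2 μ01, (∀ i, ⟪W i, f⟫ = 0) → ∀ r ∈ Set.Icc (0 : ℝ) 1,
      |∫ t, tailKernel α c r t * f t ∂μ01| ≤ ε * ‖f‖) (K : ℕ) :
    ∃ V : Finset.Icc (-K : ℤ) K ⊕ (Fin N × Fin N) → Lp ℝ 2 μ01, ∀ g, (∀ i, ⟪V i, g⟫ = 0) →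
      ‖T g‖ ≤ exp c * (circleSingularValue α c K + ε) * ‖g‖ := by
  obtain ⟨S, S', A, H, hSS, -, -, hSle, hA, hH, hTle, -⟩ := exists_comparison hα hc hT
  refine ⟨Sum.elim (fun k => S (casLp k)) fun i => S (W i), fun g hg => ?_⟩
  have hA' : ‖A (S g)‖ ≤ circleSingularValue α c K * ‖S g‖ :=
    norm_periodic_le hα hc (hA _) fun k hk => (hSS _ _).symm.trans (hg (Sum.inl ⟨k, hk⟩))
  have hH' : ‖H (S g)‖ ≤ ε * ‖S g‖ := by
    refine norm_le_of_ae_bound_μ01 (by positivity) ?_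
    filter_upwards [hH (S g), ae_μ01_mem] with r h₁ hr
    rw [h₁]
    exact hW _ (fun i => (hSS _ _).symm.trans (hg (Sum.inr i))) r hr
  have hb := (circleSingularValue_pos (by linarith : 0 < α) hc K).le
  calc ‖T g‖ ≤ ‖A (S g)‖ + ‖H (S g)‖ := (hTle g).trans (norm_sub_le _ _)
    _ ≤ (circleSingularValue α c K + ε) * ‖S g‖ := by linarith
    _ ≤ (circleSingularValue α c K + ε) * (exp c * ‖g‖) := by gcongr; exact hSle g
    _ = _ := by ring

theorem volterra_lower (hα : 1 / 2 < α) (hc : 0 < c)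
    (hT : ∀ g, T g =ᵐ[μ01] fun r => ∫ t, powExp α 0 (t - r) * g t ∂μ01)
    {W : Fin N × Fin N → Lp ℝ 2 μ01} (hε : 0 ≤ ε)
    (hW : ∀ f : Lp ℝ 2 μ01, (∀ i, ⟪W i, f⟫ = 0) → ∀ r ∈ Set.Icc (0 : ℝ) 1,
      |∫ t, tailKernel α c r t * f t ∂μ01| ≤ ε * ‖f‖) (K : ℕ)
    (hK : ε ≤ circleSingularValue α c K) :
    ∃ (e : Finset.Icc (-K : ℤ) K → Lp ℝ 2 μ01) (V : Fin N × Fin N → Lp ℝ 2 μ01),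
      LinearIndependent ℝ e ∧ ∀ v : Finset.Icc (-K : ℤ) K → ℝ,
        (∀ i, ⟪V i, ∑ k, v k • e k⟫ = 0) →
        exp (-c) * (circleSingularValue α c K - ε) * ‖∑ k, v k • e k‖ ≤ ‖T (∑ k, v k • e k)‖ := by
  obtain ⟨S, S', A, H, hSS, hS', hleS, -, hA, hH, -, hleT⟩ := exists_comparison hα hc hT
  have hcas : LinearIndependent ℝ fun k : Finset.Icc (-K : ℤ) K => casLp k :=
    orthonormal_casLp.linearIndependent.comp _ Subtype.val_injective
  refine ⟨fun k => S' (casLp k), fun i => S (W i), ?_, fun v hv => ?_⟩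
  · refine LinearIndependent.of_comp S.toLinearMap ?_
    convert hcas using 1
    funext k
    exact hS' _
  · set g := ∑ k, v k • S' (casLp k) with hg
    have hSg : S g = ∑ k, v k • casLp k := by simp [hg, hS']
    have hA' : circleSingularValue α c K * ‖S g‖ ≤ ‖A (S g)‖ := by
      refine le_norm_periodic hα hc (hA _) fun k hk => ?_
      rw [hSg, inner_sum]
      refine Finset.sum_eq_zero fun l _ => ?_
      rw [inner_smul_right, orthonormal_casLp.2 (show k ≠ l from fun h => hk (h ▸ l.2)), mul_zero]
    have hH' : ‖H (S g)‖ ≤ ε * ‖S g‖ := by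
      refine norm_le_of_ae_bound_μ01 (by positivity) ?_
      filter_upwards [hH (S g), ae_μ01_mem] with r h₁ hr
      rw [h₁]
      exact hW _ (fun i => (hSS _ _).symm.trans (hv i)) r hr
    refine le_trans ?_ (hleT g)
    rw [mul_assoc]
    gcongr
    calc (circleSingularValue α c K - ε) * ‖g‖
        ≤ (circleSingularValue α c K - ε) * ‖S g‖ :=
          mul_le_mul_of_nonneg_left (hleS g) (sub_nonneg.2 hK)
      _ ≤ ‖A (S g)‖ - ‖H (S g)‖ := by linarith
      _ ≤ _ := norm_sub_norm_le _ _

end VolterraBounds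

section Asymptotics

variable {α c : ℝ}

/-- The side length of the block of tail conditions imposed at index `j`. -/
noncomputable def tailRank (j : ℕ) : ℕ := ⌊(j : ℝ) ^ (1 / 3 : ℝ)⌋₊

theorem tendsto_natCast_rpow_third : Tendsto (fun j : ℕ => (j : ℝ) ^ (1 / 3 : ℝ)) atTop atTop :=
  (tendsto_rpow_atTop (by norm_num)).comp tendsto_natCast_atTop_atTop

theorem tendsto_tailRank_sq_div : Tendsto (fun j : ℕ => ((tailRank j : ℝ) ^ 2 + 2) / j) atTop
    (nhds 0) := by
  have h1 : Tendsto (fun j : ℕ => ((j : ℝ) ^ (1 / 3 : ℝ))⁻¹ + 2 / j) atTop (nhds 0) := by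
    simpa using tendsto_natCast_rpow_third.inv_tendsto_atTop.add
      (tendsto_const_div_atTop_nhds_zero_nat 2)
  refine squeeze_zero' (Eventually.of_forall fun j => by positivity) ?_ h1
  filter_upwards [eventually_gt_atTop 0] with j hj
  have hj' : (0 : ℝ) < j := by exact_mod_cast hj
  rw [add_div]
  gcongr
  rw [div_le_iff₀ hj', ← rpow_neg hj'.le]
  calc (tailRank j : ℝ) ^ 2 ≤ ((j : ℝ) ^ (1 / 3 : ℝ)) ^ 2 := by
        gcongr
        exact Nat.floor_le (by positivity)
    _ = (j : ℝ) ^ (-(1 / 3) : ℝ) * (j : ℝ) ^ (1 : ℝ) := by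
        rw [← rpow_natCast, ← rpow_mul hj'.le, ← rpow_add hj']
        norm_num
    _ = _ := by rw [rpow_one]

theorem tendsto_rpow_mul_pow_tailRank {θ : ℝ} (hθ : θ ∈ Set.Ioo (0 : ℝ) 1) (s : ℝ) :
    Tendsto (fun j : ℕ => (j : ℝ) ^ s * θ ^ tailRank j) atTop (nhds 0) := by
  have hb : 0 < -log θ := neg_pos.2 (log_neg hθ.1 hθ.2)
  have h := ((tendsto_rpow_mul_exp_neg_mul_atTop_nhds_zero (3 * s) (-log θ) hb).comp
    tendsto_natCast_rpow_third).mul_const θ⁻¹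
  rw [zero_mul] at h
  have hθ0 := hθ.1
  refine squeeze_zero (fun j => by positivity) (fun j => ?_) h
  simp only [Function.comp, neg_neg]
  rw [← rpow_mul (Nat.cast_nonneg j), mul_assoc, show (1 / 3 : ℝ) * (3 * s) = s by ring]
  gcongr
  rw [← rpow_natCast, rpow_def_of_pos hθ0]
  rw [show θ⁻¹ = exp (-log θ) by rw [exp_neg, exp_log hθ0], ← exp_add]
  refine exp_le_exp.2 ?_
  have := (Nat.lt_floor_add_one ((j : ℝ) ^ (1 / 3 : ℝ))).le
  rw [tailRank]
  nlinarith

/-- The square root of the predicted eigenvalue asymptotics. -/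
noncomputable def singularValueScale (α : ℝ) (j : ℕ) : ℝ := Gamma α * (π * j) ^ (-α)

theorem tendsto_circleSingularValue_div (hα : 0 < α) {K : ℕ → ℕ}
    (hK : ∀ᶠ j : ℕ in atTop, |2 * (K j : ℝ) - j| ≤ (tailRank j : ℝ) ^ 2 + 2) :
    Tendsto (fun j => circleSingularValue α c (K j) / singularValueScale α j) atTop (nhds 1) := by
  have h1 : Tendsto (fun j : ℕ => 2 * (K j : ℝ) / j) atTop (nhds 1) := by
    rw [tendsto_iff_norm_sub_tendsto_zero]
    refine squeeze_zero' (Eventually.of_forall fun j => norm_nonneg _) ?_ tendsto_tailRank_sq_div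
    filter_upwards [hK, eventually_gt_atTop 0] with j hj hj0
    have hj' : (0 : ℝ) < j := by exact_mod_cast hj0
    rw [div_sub_one hj'.ne', norm_div, norm_eq_abs, norm_of_nonneg hj'.le]
    gcongr
  have h2 : Tendsto (fun j : ℕ => (c / π / j) ^ 2 + (2 * (K j : ℝ) / j) ^ 2) atTop (nhds 1) := by
    simpa using ((tendsto_const_div_atTop_nhds_zero_nat (c / π)).pow 2).add (h1.pow 2)
  have h3 := h2.rpow_const (p := -(α / 2)) (Or.inl one_ne_zero)
  rw [one_rpow] at h3
  refine h3.congr' ?_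
  filter_upwards [eventually_gt_atTop 0] with j hj0
  have hj' : (0 : ℝ) < j := by exact_mod_cast hj0
  have hG := (Gamma_pos_of_pos hα).ne'
  have h4 : (π * j) ^ (-α) = ((π * j) ^ 2) ^ (-(α / 2)) := by
    rw [← rpow_natCast, ← rpow_mul (by positivity)]
    ring_nf
  rw [circleSingularValue, singularValueScale, mul_div_mul_left _ _ hG, h4,
    ← div_rpow (by positivity) (by positivity)]
  congr 1
  field_simp

theorem tendsto_pow_tailRank_div {θ : ℝ} (hθ : θ ∈ Set.Ioo (0 : ℝ) 1) (C : ℝ) :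
    Tendsto (fun j => C * θ ^ tailRank j / singularValueScale α j) atTop (nhds 0) := by
  have h := (tendsto_rpow_mul_pow_tailRank hθ α).const_mul (C / Gamma α * π ^ α)
  rw [mul_zero] at h
  refine h.congr fun j => ?_
  rw [singularValueScale, rpow_neg (by positivity), mul_rpow pi_pos.le (Nat.cast_nonneg j)]
  simp only [div_eq_mul_inv, mul_inv, inv_inv]
  ring

/-- Two-sided bounds by perturbed circle singular values determine the asymptotics. -/
theorem tendsto_div_of_circle_bounds (hα : 0 < α) {lam : ℕ → ℝ}
    (h : ∀ c > 0, ∃ θ ∈ Set.Ioo (0 : ℝ) 1, ∃ C > 0,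
      (∀ n N K : ℕ, 2 * K + 1 + N * N ≤ n →
        lam n ≤ (exp c * (circleSingularValue α c K + C * θ ^ N)) ^ 2) ∧
      ∀ n N K : ℕ, n + N * N < 2 * K + 1 → C * θ ^ N ≤ circleSingularValue α c K →
        (exp (-c) * (circleSingularValue α c K - C * θ ^ N)) ^ 2 ≤ lam n) :
    Tendsto (fun j => lam j / singularValueScale α j ^ 2) atTop (nhds 1) := by
  have hs : ∀ᶠ j in atTop, 0 < singularValueScale α j := by
    filter_upwards [eventually_gt_atTop 0] with j hj
    have := Gamma_pos_of_pos hα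
    unfold singularValueScale
    positivity
  have hN : ∀ᶠ j : ℕ in atTop, (tailRank j : ℝ) ^ 2 + 2 ≤ j := by
    filter_upwards [tendsto_tailRank_sq_div.eventually_le_const one_pos, eventually_gt_atTop 0]
      with j hj hj0
    exact (div_le_one (by exact_mod_cast hj0)).1 hj
  rw [tendsto_order]
  constructor
  · intro a ha
    obtain ⟨c, hca, hc⟩ : ∃ c : ℝ, a < (exp (-c) * 1) ^ 2 ∧ 0 < c := by
      have hcont : ContinuousAt (fun c : ℝ => (exp (-c) * 1) ^ 2) 0 := by fun_prop
      exact (((hcont.eventually_const_lt (by simpa using ha)).filter_mono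
        nhdsWithin_le_nhds).and self_mem_nhdsWithin :
          ∀ᶠ c in nhdsWithin (0 : ℝ) (Set.Ioi 0), _).exists
    obtain ⟨θ, hθ, C, hC, -, hlow⟩ := h c hc
    have hlim := (tendsto_circleSingularValue_div (c := c) (K := fun j =>
      (j + tailRank j * tailRank j + 1) / 2) hα ?_).sub (tendsto_pow_tailRank_div (α := α) hθ C)
    · rw [sub_zero] at hlim
      filter_upwards [hs, hlim.eventually_const_lt one_pos,
        ((hlim.const_mul (exp (-c))).pow 2).eventually_const_lt hca] with j hsj hpos hj
      refine hj.trans_le ?_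
      rw [← sub_div] at hpos ⊢
      rw [← mul_div_assoc, div_pow]
      gcongr
      refine hlow _ _ _ (by omega) ?_
      have := (div_pos_iff_of_pos_right hsj).1 hpos
      linarith
    · filter_upwards with j
      have h1 : 2 * ((j + tailRank j * tailRank j + 1) / 2) ≤ j + tailRank j * tailRank j + 1 := by
        omega
      have h2 : j + tailRank j * tailRank j ≤ 2 * ((j + tailRank j * tailRank j + 1) / 2) := by
        omega
      have h1' : (2 * ((j + tailRank j * tailRank j + 1) / 2 : ℕ) : ℝ) ≤
        j + tailRank j * tailRank j + 1 := by exact_mod_cast h1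
      have h2' : (j + tailRank j * tailRank j : ℝ) ≤
        2 * ((j + tailRank j * tailRank j + 1) / 2 : ℕ) := by exact_mod_cast h2
      rw [abs_le]
      constructor <;> nlinarith
  · intro a ha
    obtain ⟨c, hca, hc⟩ : ∃ c : ℝ, (exp c * 1) ^ 2 < a ∧ 0 < c := by
      have hcont : ContinuousAt (fun c : ℝ => (exp c * 1) ^ 2) 0 := by fun_prop
      exact (((hcont.eventually_lt_const (by simpa using ha)).filter_mono
        nhdsWithin_le_nhds).and self_mem_nhdsWithin :
          ∀ᶠ c in nhdsWithin (0 : ℝ) (Set.Ioi 0), _).exists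
    obtain ⟨θ, hθ, C, hC, hup, -⟩ := h c hc
    have hlim := (tendsto_circleSingularValue_div (c := c) (K := fun j =>
      (j - tailRank j * tailRank j - 1) / 2) hα ?_).add (tendsto_pow_tailRank_div (α := α) hθ C)
    · rw [add_zero] at hlim
      filter_upwards [hs, hN, ((hlim.const_mul (exp c)).pow 2).eventually_lt_const hca]
        with j hsj hNj hj
      refine lt_of_le_of_lt ?_ hj
      rw [← add_div, ← mul_div_assoc, div_pow]
      gcongr
      have hNj' : tailRank j * tailRank j + 2 ≤ j := by
        rw [sq] at hNj
        exact_mod_cast hNj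
      exact hup _ _ _ (by omega)
    · filter_upwards [hN] with j hNj
      have hNj' : tailRank j * tailRank j + 2 ≤ j := by
        rw [sq] at hNj
        exact_mod_cast hNj
      have h1 : 2 * ((j - tailRank j * tailRank j - 1) / 2) ≤ j := by omega
      have h2 : j ≤ 2 * ((j - tailRank j * tailRank j - 1) / 2) + tailRank j * tailRank j + 2 := by
        omega
      have h1' : (2 * ((j - tailRank j * tailRank j - 1) / 2 : ℕ) : ℝ) ≤ j := by exact_mod_cast h1
      have h2' : (j : ℝ) ≤ 2 * ((j - tailRank j * tailRank j - 1) / 2 : ℕ) +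
        tailRank j * tailRank j + 2 := by exact_mod_cast h2
      rw [abs_le]
      constructor <;> nlinarith

end Asymptotics

/-- The ordered nonzero eigenvalues of the covariance (Fredholm integral) operator
`C_ρ g(t) = ∫₀¹ g(s) K_ρ(s,t) ds` of the Riemann–Liouville process satisfy
`λ_j ~ Γ(ρ+1/2)² (π j)^{-(2ρ+1)}` as `j → ∞`. -/
theorem riemann_liouville_eigenvalue_asymptotics
    (ρ : ℝ) (hρ : 0 < ρ)
    -- `u` is an orthonormal sequence of eigenfunctions of `C_ρ` with positive eigenvalues
    -- `lam`, listed in nonincreasing order (with multiplicity)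
    (u : ℕ → Lp ℝ 2 μ01) (hu : Orthonormal ℝ u)
    (lam : ℕ → ℝ) (hlam_pos : ∀ j, 0 < lam j) (hlam_anti : Antitone lam)
    (heig : ∀ j, ∀ᵐ t ∂μ01,
      (∫ s in (0:ℝ)..1, (u j) s * rlKernel ρ s t) = lam j * (u j) t)
    -- `C_ρ` vanishes on the orthogonal complement of the `u j`, i.e. the `lam j` are *all*
    -- the nonzero eigenvalues of `C_ρ`
    (hcomplete : ∀ g : Lp ℝ 2 μ01, (∀ j, ⟪u j, g⟫ = 0) →
      ∀ᵐ t ∂μ01, (∫ s in (0:ℝ)..1, g s * rlKernel ρ s t) = 0) :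
    Tendsto (fun j : ℕ =>
        lam j / (Real.Gamma (ρ + 1/2) ^ 2 * (Real.pi * (j : ℝ)) ^ (-(2*ρ + 1))))
      atTop (nhds 1) := by
  have hα : 1 / 2 < ρ + 1 / 2 := by linarith
  obtain ⟨T, hT⟩ := (rowBoundedKernel_powExp hα le_rfl).exists_operator
  have hTu (j : ℕ) (g : Lp ℝ 2 μ01) : ⟪T (u j), T g⟫ = lam j * ⟪u j, g⟫ := by
    rw [inner_volterra_apply hρ hT, L2.inner_def, ← integral_const_mul]
    refine integral_congr_ae ((heig j).mono fun t ht => ?_)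
    simp only [ht]
    simp
    ring
  have hT0 (g : Lp ℝ 2 μ01) (hg : ∀ j, ⟪u j, g⟫ = 0) : T g = 0 := by
    rw [← inner_self_eq_zero (𝕜 := ℝ), inner_volterra_apply hρ hT]
    refine integral_eq_zero_of_ae ((hcomplete g hg).mono fun t ht => ?_)
    simp [ht]
  have hcard (K : ℕ) : Fintype.card (Finset.Icc (-K : ℤ) K) = 2 * K + 1 := by
    rw [Fintype.card_coe, Int.card_Icc]
    omega
  have h := tendsto_div_of_circle_bounds (α := ρ + 1 / 2) (by linarith) (lam := lam)
    fun c hc => ?_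
  · refine h.congr fun j => ?_
    rw [singularValueScale, mul_pow, ← rpow_mul_natCast (by positivity)]
    push_cast
    ring_nf
  · obtain ⟨θ, hθ, C, hC, hW⟩ := tailKernel_lowRank hα hc
    have hθ0 := hθ.1
    refine ⟨θ, hθ, C, hC, fun n N K hn => ?_, fun n N K hn hK => ?_⟩
    · obtain ⟨W, hW⟩ := hW N
      obtain ⟨V, hV⟩ := volterra_upper hα hc hT (by positivity) hW K
      exact eigenvalue_le_sq hu hlam_anti hTu V (by simpa [hcard] using hn) hV
    · obtain ⟨W, hW⟩ := hW N
      obtain ⟨e, V, he, hV⟩ := volterra_lower hα hc hT (by positivity) hW K hK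
      exact sq_le_eigenvalue hu hlam_pos hlam_anti hTu hT0 he V (by simpa [hcard] using hn)
        (mul_nonneg (exp_nonneg _) (sub_nonneg.2 hK)) hV
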